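/- Let ρ > 0 and let q be a C⁸ function on the closed ball {x ∈ ℝ³ : |x| ≤ ρ}. Then there exists exactly one C² function u on the double conical region D_ρ = {(x,t) ∈ ℝ³×ℝ : |x| ≤ ρ, |x| ≤ t ≤ 2ρ − |x|} satisfying ∂_t²u − Δu − q·u = 0 at every interior point of D_ρ and u(x,|x|) = ∫₀¹ q(σx) dσ for all x with |x| ≤ ρ. Moreover, if q is C^∞ on {|x| ≤ ρ} then u is C^∞ on D_ρ. -/

import Mathlib

noncomputable section

open Real MeasureTheory Metric Set

/-- Euclidean 3-space. -/
abbrev E3 : Type := EuclideanSpace ℝ (Fin 3)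

/-- The `i`-th standard basis vector of `ℝ³`. -/
def basis3 (i : Fin 3) : E3 := EuclideanSpace.single i 1

/-- The partial derivative `∂ᵢ f` of a function on `ℝ³`. -/
def pd (i : Fin 3) (f : E3 → ℝ) (x : E3) : ℝ := fderiv ℝ f x (basis3 i)

/-- The Laplacian `Δf` on `ℝ³`. -/
def lap (f : E3 → ℝ) (x : E3) : ℝ := ∑ i, pd i (pd i f) x

/-- The radial derivative `∂_r f(x) = (x/|x|)·∇f(x)`. -/
def pdr (f : E3 → ℝ) (x : E3) : ℝ := ‖x‖⁻¹ * ∑ i, x i * pd i f x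

/-- The angular derivative `Ω_{ij} f = xᵢ ∂ⱼ f − xⱼ ∂ᵢ f`. -/
def ang (i j : Fin 3) (f : E3 → ℝ) (x : E3) : ℝ := x i * pd j f x - x j * pd i f x

/-- `Ω f = Σ_{i<j} Ω_{ij}(Ω_{ij} f)`. -/
def angLap (f : E3 → ℝ) (x : E3) : ℝ :=
  ∑ i, ∑ j, if i < j then ang i j (ang i j f) x else 0

/-- The squared length `|∇f(x)|²` of the gradient. -/
def gradsq (f : E3 → ℝ) (x : E3) : ℝ := ∑ i, (pd i f x) ^ 2

/-- `Σ_{i<j} (Ω_{ij} g)²`. -/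
def angsq (g : E3 → ℝ) (x : E3) : ℝ := ∑ i, ∑ j, if i < j then (ang i j g x) ^ 2 else 0

/-- `Σ_{i<j} Σ_{k<l} (Ω_{kl} Ω_{ij} g)²`. -/
def angsq2 (g : E3 → ℝ) (x : E3) : ℝ :=
  ∑ i, ∑ j, ∑ k, ∑ l, if i < j ∧ k < l then (ang k l (ang i j g) x) ^ 2 else 0

/-- The time derivative `∂_t u` of a space-time function. -/
def pdt (u : E3 × ℝ → ℝ) (p : E3 × ℝ) : ℝ := fderiv ℝ u p (0, 1)

/-- The spatial slice `x ↦ u(x,t)` of a space-time function, at fixed time `t`. -/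
def fixT (u : E3 × ℝ → ℝ) (t : ℝ) : E3 → ℝ := fun y => u (y, t)

/-- The spatial partial derivative `∂ᵢ u` of a space-time function (`t` fixed). -/
def pdx (i : Fin 3) (u : E3 × ℝ → ℝ) (p : E3 × ℝ) : ℝ := pd i (fixT u p.2) p.1

/-- The spatial radial derivative `∂_r u` of a space-time function (`t` fixed). -/
def pdrX (u : E3 × ℝ → ℝ) (p : E3 × ℝ) : ℝ := pdr (fixT u p.2) p.1

/-- The spatial angular derivative `Ω_{ij} u` of a space-time function (`t` fixed). -/
def angX (i j : Fin 3) (u : E3 × ℝ → ℝ) (p : E3 × ℝ) : ℝ := ang i j (fixT u p.2) p.1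

/-- The spatial operator `Ω u` of a space-time function (`t` fixed). -/
def angLapX (u : E3 × ℝ → ℝ) (p : E3 × ℝ) : ℝ := angLap (fixT u p.2) p.1

/-- The spatial Laplacian `Δu` of a space-time function (`t` fixed). -/
def lapX (u : E3 × ℝ → ℝ) (p : E3 × ℝ) : ℝ := lap (fixT u p.2) p.1

/-- The squared spatial gradient `|∇u|²` of a space-time function (`t` fixed). -/
def gradsqX (u : E3 × ℝ → ℝ) (p : E3 × ℝ) : ℝ := gradsq (fixT u p.2) p.1

/-- `Σ_{i<j} (Ω_{ij} w)²` for a space-time function (`t` fixed). -/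
def angsqX (w : E3 × ℝ → ℝ) (p : E3 × ℝ) : ℝ :=
  ∑ i, ∑ j, if i < j then (angX i j w p) ^ 2 else 0

/-- The solid light cone `t ≥ |x|`. -/
def cone : Set (E3 × ℝ) := {p | ‖p.1‖ ≤ p.2}

/-- `u` is a C² solution of the Goursat problem for `q` on the cone `t ≥ |x|`:
`∂_t²u − Δu − q u = 0` for `t > |x|` and `u(x,|x|) = ∫₀¹ q(σx) dσ`. -/
def GoursatSol (q : E3 → ℝ) (u : E3 × ℝ → ℝ) : Prop :=
  ContDiffOn ℝ 2 u cone ∧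
  (∀ p : E3 × ℝ, ‖p.1‖ < p.2 → pdt (pdt u) p - lapX u p - q p.1 * u p = 0) ∧
  (∀ x : E3, u (x, ‖x‖) = ∫ σ in (0:ℝ)..1, q (σ • x))

/-- `p(x) = ∫₀^{|x|} q(σ x/|x|) dσ`. -/
def pfun (q : E3 → ℝ) (x : E3) : ℝ := ∫ σ in (0:ℝ)..‖x‖, q ((σ / ‖x‖) • x)

/-- Integral over the sphere of radius `r` with respect to surface measure. -/
def sphInt (r : ℝ) (g : E3 → ℝ) : ℝ := ∫ x in sphere (0:E3) r, g x ∂μH[2]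

/-- Squared `L²` norm on the sphere of radius `r`. -/
def L2sq (g : E3 → ℝ) (r : ℝ) : ℝ := sphInt r (fun x => (g x) ^ 2)

/-- Squared `H¹` norm on the sphere of radius `r`. -/
def H1sq (g : E3 → ℝ) (r : ℝ) : ℝ := sphInt r (fun x => (g x) ^ 2 + (r ^ 2)⁻¹ * angsq g x)

/-- Squared `H²` norm on the sphere of radius `r`. -/
def H2sq (g : E3 → ℝ) (r : ℝ) : ℝ := H1sq g r + sphInt r (fun x => (r ^ 4)⁻¹ * angsq2 g x)

/-- The class `Q_γ(R,T)`. -/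
def memQ (R T γ : ℝ) (q : E3 → ℝ) : Prop :=
  ∀ r ∈ Icc R ((R + T) / 2),
    Real.sqrt (H2sq (pfun q) r) + Real.sqrt (H1sq (pdr (pfun q)) r) ≤
      γ * (Real.sqrt (H1sq (pfun q) r) + Real.sqrt (L2sq (pdr (pfun q)) r))

/-- The closed annulus `R ≤ |x| ≤ ρ` in `ℝ³`. -/
def Ann (R ρ : ℝ) : Set E3 := {x | R ≤ ‖x‖ ∧ ‖x‖ ≤ ρ}

/-- The space-time region `K_ρ = {R ≤ |x| ≤ ρ, |x| ≤ t ≤ R+T−|x|}`. -/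
def Kreg (R T ρ : ℝ) : Set (E3 × ℝ) :=
  {p | R ≤ ‖p.1‖ ∧ ‖p.1‖ ≤ ρ ∧ ‖p.1‖ ≤ p.2 ∧ p.2 ≤ R + T - ‖p.1‖}

/-- `F = ∂_t²w − ∂_r∂_r w − |x|^{-2} Ω w`. -/
def Fop (w : E3 × ℝ → ℝ) (p : E3 × ℝ) : ℝ :=
  pdt (pdt w) p - pdrX (pdrX w) p - (‖p.1‖ ^ 2)⁻¹ * angLapX w p

/-- The sideways energy `J(ρ)`. -/
def Jfun (R T : ℝ) (w : E3 × ℝ → ℝ) (ρ : ℝ) : ℝ :=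
  ∫ t in ρ..(R + T - ρ), sphInt ρ
    (fun x => (ρ ^ 2)⁻¹ * ((w (x, t)) ^ 2 + (pdt w (x, t)) ^ 2 + gradsqX w (x, t)))

/-- The double conical region `D_ρ = {|x| ≤ ρ, |x| ≤ t ≤ 2ρ − |x|}`. -/
def Dcone (ρ : ℝ) : Set (E3 × ℝ) :=
  {p | ‖p.1‖ ≤ ρ ∧ ‖p.1‖ ≤ p.2 ∧ p.2 ≤ 2 * ρ - ‖p.1‖}

/-- `u` is a C² solution of the Goursat problem for `q` on the double conical region `D_ρ`. -/
def IsSolOn (ρ : ℝ) (q : E3 → ℝ) (u : E3 × ℝ → ℝ) : Prop :=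
  ContDiffOn ℝ 2 u (Dcone ρ) ∧
  (∀ p ∈ interior (Dcone ρ), pdt (pdt u) p - lapX u p - q p.1 * u p = 0) ∧
  (∀ x : E3, ‖x‖ ≤ ρ → u (x, ‖x‖) = ∫ σ in (0:ℝ)..1, q (σ • x))

/-- The radial field `x ↦ (‖x‖² − ρ²) / (2ρ²) • x`, vanishing on the sphere of radius `ρ`. -/
def radField (ρ : ℝ) (x : E3) : E3 := ((‖x‖ ^ 2 - ρ ^ 2) / (2 * ρ ^ 2)) • x

lemma contDiff_radField (ρ : ℝ) {n : WithTop ℕ∞} : ContDiff ℝ n (radField ρ) := by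
  unfold radField
  exact (((contDiff_norm_sq ℝ).sub contDiff_const).div_const _).smul contDiff_id

lemma radField_of_norm_eq {ρ : ℝ} {x : E3} (hx : ‖x‖ = ρ) : radField ρ x = 0 := by
  simp [radField, hx]

lemma norm_sub_smul_radField_le {ρ μ : ℝ} (hρ : 0 < ρ) (hμ : 1 ≤ μ) {x : E3} (hx : ρ ≤ ‖x‖)
    (hx' : μ * (‖x‖ ^ 2 - ρ ^ 2) ≤ 2 * ρ ^ 2) : ‖x - μ • radField ρ x‖ ≤ ρ := by
  have h : x - μ • radField ρ x = (1 - μ * ((‖x‖ ^ 2 - ρ ^ 2) / (2 * ρ ^ 2))) • x := by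
    rw [radField, sub_smul, one_smul, mul_smul]
  have h0 : 0 ≤ 1 - μ * ((‖x‖ ^ 2 - ρ ^ 2) / (2 * ρ ^ 2)) := by
    rw [← mul_div_assoc, sub_nonneg, div_le_one (by positivity)]
    exact hx'
  rw [h, norm_smul, Real.norm_of_nonneg h0]
  set r := ‖x‖
  have h1 : (r ^ 2 - ρ ^ 2) / (2 * ρ ^ 2) ≤ μ * ((r ^ 2 - ρ ^ 2) / (2 * ρ ^ 2)) := by
    refine le_mul_of_one_le_left (div_nonneg ?_ (by positivity)) hμ
    nlinarith
  have h2 : (1 - (r ^ 2 - ρ ^ 2) / (2 * ρ ^ 2)) * r ≤ ρ := by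
    have : ρ - (1 - (r ^ 2 - ρ ^ 2) / (2 * ρ ^ 2)) * r =
        (r - ρ) * ((r + ρ) * r - 2 * ρ ^ 2) / (2 * ρ ^ 2) := by
      field_simp
      ring
    have h3 : 0 ≤ (r - ρ) * ((r + ρ) * r - 2 * ρ ^ 2) / (2 * ρ ^ 2) := by
      refine div_nonneg (mul_nonneg (by linarith) (by nlinarith)) (by positivity)
    linarith
  have : 0 ≤ r := norm_nonneg x
  nlinarith

/-- Hestenes-type extension across the sphere of radius `ρ`. -/
def reflGlue {F : Type} [NormedAddCommGroup F] [NormedSpace ℝ F] (ρ : ℝ) (N : ℕ) (μ c : ℕ → ℝ)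
    (a : ℝ) (f : E3 → F) (x : E3) : F :=
  open Classical in
  if ‖x‖ ≤ ρ then a • f x else ∑ j ∈ Finset.range N, c j • f (x - μ j • radField ρ x)

section Glue

variable {F : Type} [NormedAddCommGroup F] [NormedSpace ℝ F] {ρ : ℝ} {N : ℕ} {μ c : ℕ → ℝ} {a : ℝ}

lemma reflGlue_of_le {f : E3 → F} {x : E3} (hx : ‖x‖ ≤ ρ) : reflGlue ρ N μ c a f x = a • f x :=
  if_pos hx

lemma reflGlue_of_ge {f : E3 → F} {x : E3} (hc : ∑ j ∈ Finset.range N, c j = a) (hx : ρ ≤ ‖x‖) :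
    reflGlue ρ N μ c a f x = ∑ j ∈ Finset.range N, c j • f (x - μ j • radField ρ x) := by
  rcases hx.eq_or_lt with h | h
  · rw [reflGlue_of_le h.ge]
    simp [radField_of_norm_eq h.symm, ← Finset.sum_smul, hc]
  · exact if_neg (not_le.2 h)

lemma contDiffOn_reflGlue {ρ' : ℝ} (hρ : 0 < ρ)
    (hmap : ∀ j < N, ∀ x : E3, ρ ≤ ‖x‖ → ‖x‖ < ρ' → ‖x - μ j • radField ρ x‖ ≤ ρ) (n : ℕ)
    {f : E3 → F} (hf : ContDiffOn ℝ n f (closedBall 0 ρ))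
    (hc : ∀ m ≤ n, ∑ j ∈ Finset.range N, c j * μ j ^ m = a * 0 ^ m) :
    ContDiffOn ℝ n (reflGlue ρ N μ c a f) (ball 0 ρ') := by
  have hU : ball (0 : E3) ρ' ⊆ closedBall 0 ρ ∪ {x | ρ ≤ ‖x‖ ∧ ‖x‖ < ρ'} := by
    intro x hx
    rw [mem_ball_zero_iff] at hx
    rcases le_total ‖x‖ ρ with h | h
    · exact Or.inl (by simpa using h)
    · exact Or.inr ⟨h, hx⟩
  have hclB : IsClosed (closedBall (0 : E3) ρ) := isClosed_closedBall
  have hclS : ∀ x : E3, ‖x‖ < ρ → x ∉ closure {x : E3 | ρ ≤ ‖x‖ ∧ ‖x‖ < ρ'} := by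
    intro x hx h
    have : x ∈ {x : E3 | ρ ≤ ‖x‖} :=
      closure_minimal (fun y hy => hy.1) (isClosed_le continuous_const continuous_norm) h
    exact absurd this (not_le.2 hx)
  have huB : UniqueDiffOn ℝ (closedBall (0 : E3) ρ) :=
    uniqueDiffOn_convex (convex_closedBall _ _)
      (by rw [interior_closedBall _ hρ.ne']; exact nonempty_ball.2 hρ)
  have hmapS : ∀ j < N, MapsTo (fun x : E3 => x - μ j • radField ρ x)
      {x | ρ ≤ ‖x‖ ∧ ‖x‖ < ρ'} (closedBall 0 ρ) := fun j hj x hx => by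
    simpa using hmap j hj x hx.1 hx.2
  induction n generalizing F c a with
  | zero =>
    have hc0 : ∑ j ∈ Finset.range N, c j = a := by simpa using hc 0 le_rfl
    rw [Nat.cast_zero, contDiffOn_zero] at hf ⊢
    intro x hx
    refine ContinuousWithinAt.mono ?_ hU
    refine ContinuousWithinAt.union ?_ ?_
    · by_cases hxB : x ∈ closedBall (0 : E3) ρ
      · exact ((hf x hxB).const_smul a).congr (fun y hy => reflGlue_of_le (by simpa using hy))
          (reflGlue_of_le (by simpa using hxB))
      · exact continuousWithinAt_of_notMem_closure (by rwa [hclB.closure_eq])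
    · rcases lt_or_ge ‖x‖ ρ with h | h
      · exact continuousWithinAt_of_notMem_closure (hclS x h)
      · have hxS : x ∈ {x : E3 | ρ ≤ ‖x‖ ∧ ‖x‖ < ρ'} := ⟨h, by simpa using hx⟩
        refine ContinuousWithinAt.congr (f := fun x => ∑ j ∈ Finset.range N,
          c j • f (x - μ j • radField ρ x)) ?_ (fun y hy => reflGlue_of_ge hc0 hy.1)
          (reflGlue_of_ge hc0 h)
        have hj : ∀ j ∈ Finset.range N, ContinuousWithinAt
            (fun x => c j • f (x - μ j • radField ρ x)) {x : E3 | ρ ≤ ‖x‖ ∧ ‖x‖ < ρ'} x := by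
          intro j hj
          have h1 := hf _ (hmapS j (Finset.mem_range.1 hj) hxS)
          have h2 : Continuous fun x : E3 => x - μ j • radField ρ x :=
            have := (contDiff_radField ρ (n := 0)).continuous
            by fun_prop
          have h3 := ContinuousWithinAt.comp (x := x) (f := fun x : E3 => x - μ j • radField ρ x)
            h1 h2.continuousWithinAt (hmapS j (Finset.mem_range.1 hj))
          exact h3.const_smul (c j)
        exact tendsto_finsetSum _ hj
  | succ n ih =>
    have hc0 : ∑ j ∈ Finset.range N, c j = a := by simpa using hc 0 (by omega)
    have hc1 : ∑ j ∈ Finset.range N, c j * μ j = 0 := by simpa using hc 1 (by omega)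
    set f' : E3 → E3 →L[ℝ] F := fderivWithin ℝ f (closedBall 0 ρ) with hf'
    have hfd : ∀ x ∈ closedBall (0 : E3) ρ, HasFDerivWithinAt f (f' x) (closedBall 0 ρ) x :=
      fun x hx => ((hf.differentiableOn (by simp)) x hx).hasFDerivWithinAt
    have hf'c : ContDiffOn ℝ n f' (closedBall 0 ρ) := hf.fderivWithin huB (by norm_cast)
    set D : E3 → E3 →L[ℝ] F := fun x => reflGlue ρ N μ c a f' x -
      (reflGlue ρ N μ (fun j => c j * μ j) 0 f' x).comp (fderiv ℝ (radField ρ) x) with hD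
    have hDc : ContDiffOn ℝ n D (ball 0 ρ') := by
      refine (ih hf'c fun m hm => hc m (by omega)).sub
        (ContDiffOn.clm_comp (ih hf'c fun m hm => ?_)
          ((contDiff_radField ρ (n := n + 1)).fderiv_right le_rfl).contDiffOn)
      have := hc (m + 1) (by omega)
      simpa [pow_succ, mul_assoc, mul_comm, mul_left_comm] using this
    have hder : ∀ x ∈ ball (0 : E3) ρ', HasFDerivAt (reflGlue ρ N μ c a f) (D x) x := by
      intro x hx
      refine HasFDerivWithinAt.hasFDerivAt (s := ball 0 ρ') (HasFDerivWithinAt.mono ?_ hU)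
        (isOpen_ball.mem_nhds hx)
      refine HasFDerivWithinAt.union ?_ ?_
      · by_cases hxB : x ∈ closedBall (0 : E3) ρ
        · have hxn : ‖x‖ ≤ ρ := by simpa using hxB
          have : D x = a • f' x := by
            simp [hD, reflGlue_of_le hxn]
          rw [this]
          exact ((hfd x hxB).const_smul a).congr (fun y hy => reflGlue_of_le (by simpa using hy))
            (reflGlue_of_le hxn)
        · exact HasFDerivWithinAt.of_notMem_closure (by rwa [hclB.closure_eq])
      · rcases lt_or_ge ‖x‖ ρ with h | h
        · exact HasFDerivWithinAt.of_notMem_closure (hclS x h)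
        · have hxS : x ∈ {x : E3 | ρ ≤ ‖x‖ ∧ ‖x‖ < ρ'} := ⟨h, by simpa using hx⟩
          refine HasFDerivWithinAt.congr (f := fun x => ∑ j ∈ Finset.range N,
            c j • f (x - μ j • radField ρ x)) ?_ (fun y hy => reflGlue_of_ge hc0 hy.1)
            (reflGlue_of_ge hc0 h)
          have hDx : D x = ∑ j ∈ Finset.range N, c j • (f' (x - μ j • radField ρ x)).comp
              (ContinuousLinearMap.id ℝ E3 - μ j • fderiv ℝ (radField ρ) x) := by
            simp only [hD]
            rw [reflGlue_of_ge hc0 h, reflGlue_of_ge hc1 h]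
            ext v
            simp [smul_sub, Finset.sum_sub_distrib, mul_smul]
          rw [hDx]
          refine HasFDerivWithinAt.fun_sum fun j hj => HasFDerivWithinAt.const_smul ?_ (c j)
          have hj' := Finset.mem_range.1 hj
          refine HasFDerivWithinAt.comp (t := closedBall 0 ρ) x (hfd _ (hmapS j hj' hxS)) ?_
            (hmapS j hj')
          exact ((hasFDerivAt_id x).sub ((((contDiff_radField ρ (n := 1)).differentiable
            (by simp)) x).hasFDerivAt.const_smul (μ j))).hasFDerivWithinAt
    have : ((n + 1 : ℕ) : WithTop ℕ∞) = n + 1 := by norm_cast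
    rw [this, contDiffOn_succ_iff_fderiv_of_isOpen isOpen_ball]
    refine ⟨fun x hx => (hder x hx).differentiableAt.differentiableWithinAt, by simp, ?_⟩
    exact hDc.congr fun x hx => (hder x hx).fderiv

end Glue

lemma exists_moment_weights (n : ℕ) : ∃ c : ℕ → ℝ,
    ∀ m ≤ n, ∑ j ∈ Finset.range (n + 1), c j * ((j : ℝ) + 1) ^ m = 1 * 0 ^ m := by
  refine ⟨fun j => -((-1) ^ (n + 1) * ((-1) ^ (n - j) * ((n + 1).choose (j + 1)))),
    fun m hm => ?_⟩
  have h := fwdDiff_iter_eq_sum_shift (1 : ℝ) (fun r : ℝ => r ^ m) (n + 1) 0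
  rw [fwdDiff_iter_pow_eq_zero_of_lt (by omega), Finset.sum_range_succ'] at h
  simp only [Pi.zero_apply, Nat.add_sub_add_right, zsmul_eq_mul, zero_add, nsmul_eq_mul, mul_one,
    Nat.sub_zero, Nat.choose_zero_right, Nat.cast_one, Nat.cast_add, CharP.cast_eq_zero] at h
  push_cast at h
  have h2 : ((-1 : ℝ) ^ (n + 1)) * (-1) ^ (n + 1) = 1 := by
    rw [← mul_pow]
    simp
  have h3 : ∑ j ∈ Finset.range (n + 1), -((-1 : ℝ) ^ (n + 1) * ((-1) ^ (n - j) *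
      ((n + 1).choose (j + 1)))) * ((j : ℝ) + 1) ^ m = -(-1) ^ (n + 1) *
      ∑ j ∈ Finset.range (n + 1), (-1) ^ (n - j) * ((n + 1).choose (j + 1)) *
        ((j : ℝ) + 1) ^ m := by
    rw [Finset.mul_sum]
    exact Finset.sum_congr rfl fun j _ => by ring
  rw [h3]
  linear_combination (-1 : ℝ) ^ (n + 1) * h + 0 ^ m * h2

/-- A `C^n` function on a closed ball of `ℝ³` extends to a `C^n` function on `ℝ³`. -/
theorem exists_contDiff_extension {ρ : ℝ} (hρ : 0 < ρ) (n : ℕ) {q : E3 → ℝ}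
    (hq : ContDiffOn ℝ n q (closedBall 0 ρ)) :
    ∃ Q : E3 → ℝ, ContDiff ℝ n Q ∧ EqOn Q q (closedBall 0 ρ) := by
  obtain ⟨c, hc⟩ := exists_moment_weights n
  obtain ⟨ρ', h1, h2⟩ : ∃ ρ', ρ < ρ' ∧ ((n : ℝ) + 1) * (ρ' ^ 2 - ρ ^ 2) ≤ 2 * ρ ^ 2 := by
    refine ⟨ρ * √(1 + 1 / (n + 1)), ?_, ?_⟩
    · refine lt_mul_of_one_lt_right hρ ?_
      rw [Real.lt_sqrt (by norm_num)]
      have : (0 : ℝ) < 1 / (n + 1) := by positivity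
      linarith
    · rw [mul_pow, Real.sq_sqrt (by positivity)]
      have : ((n : ℝ) + 1) * (ρ ^ 2 * (1 + 1 / (n + 1)) - ρ ^ 2) = ρ ^ 2 := by
        field_simp
        ring
      nlinarith
  have hG := contDiffOn_reflGlue (ρ' := ρ') (N := n + 1) (μ := fun j => (j : ℝ) + 1) (c := c)
    (a := 1) hρ (fun j hj x hx hx' => by
      refine norm_sub_smul_radField_le hρ (by simp) hx (le_trans ?_ h2)
      have : (j : ℝ) + 1 ≤ n + 1 := by
        have : (j : ℝ) ≤ n := by exact_mod_cast Nat.lt_succ_iff.1 hj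
        linarith
      have h3 : ‖x‖ ^ 2 ≤ ρ' ^ 2 := by gcongr
      have h4 : ρ ^ 2 ≤ ‖x‖ ^ 2 := by gcongr
      have : (0 : ℝ) ≤ (j : ℝ) + 1 := by positivity
      nlinarith) n hq hc
  let β : ContDiffBump (0 : E3) := ⟨ρ, (ρ + ρ') / 2, hρ, by linarith⟩
  refine ⟨fun x => β x * reflGlue ρ (n + 1) (fun j => (j : ℝ) + 1) c 1 q x, ?_, fun x hx => ?_⟩
  · rw [contDiff_iff_contDiffAt]
    intro x
    by_cases hx : x ∈ ball (0 : E3) ρ'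
    · exact β.contDiff.contDiffAt.mul (hG.contDiffAt (isOpen_ball.mem_nhds hx))
    · have hx' : x ∉ tsupport β := by
        rw [β.tsupport_eq]
        simp only [mem_ball_zero_iff, mem_closedBall_zero_iff, not_lt, not_le] at hx ⊢
        change (ρ + ρ') / 2 < ‖x‖
        linarith
      refine (contDiffAt_const (c := (0 : ℝ))).congr_of_eventuallyEq ?_
      filter_upwards [notMem_tsupport_iff_eventuallyEq.1 hx'] with y hy
      simp [hy]
  · have : β x = 1 := β.one_of_mem_closedBall hx
    simp [this, reflGlue_of_le (mem_closedBall_zero_iff.1 hx)]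

/-- Space-time. -/
abbrev Spt : Type := E3 × ℝ

/-- The retarded convolution `∫ k(y) f(x - y, t - |y|) dy`. -/
def retConv {F : Type} [NormedAddCommGroup F] [NormedSpace ℝ F] (k : E3 → ℝ) (f : Spt → F)
    (p : Spt) : F := ∫ y : E3, k y • f (p - (y, ‖y‖))

lemma volume_ellipsoid_eq_zero (x : E3) (t : ℝ) :
    volume {y : E3 | ‖y‖ + dist y x = t} = 0 := by
  have hconv : ConvexOn ℝ univ (fun y : E3 => ‖y‖ + dist y x) :=
    (convexOn_univ_norm).add (convexOn_univ_dist x)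
  have hcont : Continuous (fun y : E3 => ‖y‖ + dist y x) := by fun_prop
  by_cases hne : ∃ z : E3, ‖z‖ + dist z x < t
  · obtain ⟨z, hz⟩ := hne
    have hC : Convex ℝ {y : E3 | ‖y‖ + dist y x < t} := by
      simpa using hconv.convex_lt t
    refine measure_mono_null ?_ (hC.addHaar_frontier volume)
    intro y hy
    rw [mem_ofPred_eq] at hy
    rw [(isOpen_lt hcont continuous_const).frontier_eq]
    refine ⟨?_, fun h => by rw [mem_ofPred_eq] at h; linarith⟩
    have hcl : Filter.Tendsto (fun s : ℝ => (1 - s) • y + s • z) (nhdsWithin 0 (Ioi 0)) (nhds y) := by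
      have : Continuous (fun s : ℝ => (1 - s) • y + s • z) := by fun_prop
      have h := this.tendsto 0
      simp only [sub_zero, one_smul, zero_smul, add_zero] at h
      exact h.mono_left nhdsWithin_le_nhds
    refine mem_closure_of_tendsto hcl ?_
    have : ∀ᶠ s : ℝ in nhdsWithin 0 (Ioi 0), s ∈ Ioo (0:ℝ) 1 := Ioo_mem_nhdsGT one_pos
    filter_upwards [this] with s hs
    have h := hconv.2 (mem_univ y) (mem_univ z) (by linarith [hs.2] : 0 ≤ 1 - s) hs.1.le (by ring)
    simp only [smul_eq_mul] at h
    change ‖(1 - s) • y + s • z‖ + dist ((1 - s) • y + s • z) x < t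
    nlinarith [hs.1, hs.2]
  · push Not at hne
    have hsub : {y : E3 | ‖y‖ + dist y x = t} ⊆ (Submodule.span ℝ {x} : Submodule ℝ E3) := by
      intro y hy
      rw [mem_ofPred_eq] at hy
      have h0 := hne 0
      have ht : dist (0:E3) y + dist y x = dist (0:E3) x := by
        have := dist_triangle (0:E3) y x
        simp only [norm_zero, zero_add] at h0
        rw [dist_zero_left y] at *
        linarith
      rw [dist_add_dist_eq_iff] at ht
      obtain ⟨s, -, rfl⟩ := ht
      simp only [AffineMap.lineMap_apply, vsub_eq_sub, sub_zero, vadd_eq_add, add_zero]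
      exact Submodule.smul_mem _ _ (Submodule.mem_span_singleton_self x)
    refine measure_mono_null hsub (Measure.addHaar_submodule volume _ ?_)
    intro htop
    have h1 : Module.finrank ℝ (Submodule.span ℝ {x} : Submodule ℝ E3) = 3 := by
      rw [htop, finrank_top]; simp
    have h2 := finrank_span_le_card (R := ℝ) ({x} : Set E3)
    simp at h2
    omega

lemma ae_norm_ne_of_sub (p : Spt) :
    ∀ᵐ y : E3, ‖(p - (y, ‖y‖)).1‖ ≠ (p - (y, ‖y‖)).2 := by
  rw [ae_iff]
  refine measure_mono_null ?_ (volume_ellipsoid_eq_zero p.1 p.2)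
  intro y hy
  simp only [Prod.fst_sub, Prod.snd_sub, ne_eq, not_not, mem_ofPred_eq] at hy ⊢
  rw [dist_comm, dist_eq_norm, hy]; ring

lemma LocallyLipschitz.exists_lipschitzWith_of_hasCompactSupport {E F : Type}
    [NormedAddCommGroup E] [NormedSpace ℝ E] [ProperSpace E]
    [NormedAddCommGroup F] {f : E → F} (hf : LocallyLipschitz f) (hc : HasCompactSupport f) :
    ∃ K, LipschitzWith K f := by
  obtain ⟨R, hR⟩ := hc.isCompact.isBounded.subset_closedBall (0:E)
  obtain ⟨K, hK⟩ := (hf.locallyLipschitzOn (s := closedBall (0:E) (R + 1))).exists_lipschitzOnWith_of_compact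
    (isCompact_closedBall (0:E) (R + 1))
  have hz : ∀ x, x ∉ closedBall (0:E) R → f x = 0 := fun x hx =>
    image_eq_zero_of_notMem_tsupport fun h => hx (hR h)
  obtain ⟨C, hC⟩ := hf.continuous.bounded_above_of_compact_support hc
  have hC0 : 0 ≤ C := (norm_nonneg _).trans (hC 0)
  refine ⟨K + C.toNNReal, LipschitzWith.of_dist_le_mul fun x y => ?_⟩
  have aux : ∀ x y : E, x ∈ closedBall (0:E) R →
      dist (f x) (f y) ≤ (K + C.toNNReal : NNReal) * dist x y := by
    intro x y hx
    have hx' : x ∈ closedBall (0:E) (R + 1) := closedBall_subset_closedBall (by linarith) hx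
    push_cast
    rw [Real.coe_toNNReal _ hC0, add_mul]
    have hd := dist_nonneg (x := x) (y := y)
    by_cases hy : y ∈ closedBall (0:E) (R + 1)
    · have := hK.dist_le_mul x hx' y hy
      nlinarith
    · have hy0 : f y = 0 := hz y fun h => hy (closedBall_subset_closedBall (by linarith) h)
      rw [hy0, dist_zero_right]
      have h1 : 1 ≤ dist x y := by
        simp only [mem_closedBall, not_le] at hx hy
        have := dist_triangle y x 0
        rw [dist_comm y x] at this
        linarith
      have := hC x
      have hK0 : 0 ≤ (K:ℝ) * dist x y := by positivity
      nlinarith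
  by_cases hx : x ∈ closedBall (0:E) R
  · exact aux x y hx
  · by_cases hy : y ∈ closedBall (0:E) R
    · rw [dist_comm, dist_comm x y]; exact aux y x hy
    · rw [hz x hx, hz y hy, dist_self]; positivity

section conv
variable {F : Type} [NormedAddCommGroup F] [NormedSpace ℝ F]

lemma continuous_sub_cone (p : Spt) : Continuous fun y : E3 => p - (y, ‖y‖) := by fun_prop

lemma norm_retConv_le {k : E3 → ℝ} (hk : Integrable k) {f : Spt → F} {C : ℝ}
    (hC : ∀ p, ‖f p‖ ≤ C) (p : Spt) : ‖retConv k f p‖ ≤ (∫ y, ‖k y‖) * C := by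
  rw [← integral_mul_const]
  refine norm_integral_le_of_norm_le (hk.norm.mul_const C) (ae_of_all _ fun y => ?_)
  rw [norm_smul]
  exact mul_le_mul_of_nonneg_left (hC _) (norm_nonneg _)

lemma aestronglyMeasurable_retConv {k : E3 → ℝ} (hk : Integrable k) {f : Spt → F}
    (hf : StronglyMeasurable f) (p : Spt) :
    AEStronglyMeasurable (fun y : E3 => k y • f (p - (y, ‖y‖))) :=
  hk.aestronglyMeasurable.smul
    (hf.comp_measurable (continuous_sub_cone p).measurable).aestronglyMeasurable

lemma integrable_retConv {k : E3 → ℝ} (hk : Integrable k) {f : Spt → F}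
    (hf : StronglyMeasurable f) {C : ℝ} (hC : ∀ p, ‖f p‖ ≤ C) (p : Spt) :
    Integrable (fun y : E3 => k y • f (p - (y, ‖y‖))) := by
  refine (hk.norm.mul_const C).mono' (aestronglyMeasurable_retConv hk hf p)
    (ae_of_all _ fun y => ?_)
  rw [norm_smul]
  exact mul_le_mul_of_nonneg_left (hC _) (norm_nonneg _)

lemma continuous_retConv {k : E3 → ℝ} (hk : Integrable k) {f : Spt → F}
    (hf : StronglyMeasurable f) {C : ℝ} (hC : ∀ p, ‖f p‖ ≤ C)
    (hcont : ∀ p : Spt, ‖p.1‖ ≠ p.2 → ContinuousAt f p) : Continuous (retConv k f) := by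
  rw [continuous_iff_continuousAt]
  intro p
  refine continuousAt_of_dominated (bound := fun y => ‖k y‖ * C)
    (Filter.Eventually.of_forall fun q => aestronglyMeasurable_retConv hk hf q)
    (Filter.Eventually.of_forall fun q => ae_of_all _ fun y => ?_) (hk.norm.mul_const C) ?_
  · rw [norm_smul]
    exact mul_le_mul_of_nonneg_left (hC _) (norm_nonneg _)
  · filter_upwards [ae_norm_ne_of_sub p] with y hy
    have h1 : ContinuousAt (fun q : Spt => q - (y, ‖y‖)) p := by fun_prop
    have h2 : ContinuousAt f ((fun q : Spt => q - (y, ‖y‖)) p) := hcont _ hy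
    exact (ContinuousAt.comp (f := fun q : Spt => q - (y, ‖y‖)) h2 h1).const_smul (k y)

lemma hasFDerivAt_retConv {k : E3 → ℝ} (hk : Integrable k) {f : Spt → F} {K : NNReal}
    (hf : LipschitzWith K f) {C : ℝ} (hC : ∀ p, ‖f p‖ ≤ C) {f' : Spt → Spt →L[ℝ] F}
    (hf' : StronglyMeasurable f') (hd : ∀ p : Spt, ‖p.1‖ ≠ p.2 → HasFDerivAt f (f' p) p) (p : Spt) :
    HasFDerivAt (retConv k f) (retConv k f' p) p := by
  have hfm : StronglyMeasurable f := hf.continuous.stronglyMeasurable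
  refine (hasFDerivAt_integral_of_dominated_loc_of_lip (bound := fun y => ‖k y‖ * K)
    (s := univ) (F' := fun y => k y • f' (p - (y, ‖y‖))) Filter.univ_mem
    (Filter.Eventually.of_forall fun q => aestronglyMeasurable_retConv hk hfm q)
    (integrable_retConv hk hfm hC p) (aestronglyMeasurable_retConv hk hf' p)
    (ae_of_all _ fun y => ?_) (hk.norm.mul_const _) ?_).2
  · refine LipschitzOnWith.of_dist_le_mul fun a _ b _ => ?_
    rw [dist_smul₀, Real.coe_nnabs, abs_of_nonneg (by positivity), mul_assoc]
    refine mul_le_mul_of_nonneg_left ?_ (norm_nonneg _)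
    simpa using hf.dist_le_mul (a - (y, ‖y‖)) (b - (y, ‖y‖))
  · filter_upwards [ae_norm_ne_of_sub p] with y hy
    have h1 : HasFDerivAt (fun q : Spt => q - (y, ‖y‖)) (ContinuousLinearMap.id ℝ Spt) p :=
      (hasFDerivAt_id p).sub_const _
    have := (hd _ hy).comp p h1
    exact this.const_smul (k y)

end conv

section BddC
variable {F : Type} [NormedAddCommGroup F] [NormedSpace ℝ F]

/-- `f` is `C^m` with all derivatives up to order `m` bounded by `A`. -/
def BddC (m : ℕ) (f : Spt → F) (A : ℝ) : Prop :=
  ContDiff ℝ m f ∧ ∀ i ≤ m, ∀ p, ‖iteratedFDeriv ℝ i f p‖ ≤ A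

lemma BddC.norm_le {m : ℕ} {f : Spt → F} {A : ℝ} (h : BddC m f A) (p : Spt) : ‖f p‖ ≤ A := by
  simpa using h.2 0 (Nat.zero_le _) p

lemma BddC.nonneg {m : ℕ} {f : Spt → F} {A : ℝ} (h : BddC m f A) : 0 ≤ A :=
  (norm_nonneg _).trans (h.norm_le 0)

lemma bddC_zero {f : Spt → F} {A : ℝ} : BddC 0 f A ↔ Continuous f ∧ ∀ p, ‖f p‖ ≤ A := by
  unfold BddC
  simp [contDiff_zero]

lemma bddC_succ {m : ℕ} {f : Spt → F} {A : ℝ} : BddC (m + 1) f A ↔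
    Differentiable ℝ f ∧ (∀ p, ‖f p‖ ≤ A) ∧ BddC m (fderiv ℝ f) A := by
  constructor
  · intro h
    have h1 := h.1
    push_cast at h1
    rw [contDiff_succ_iff_fderiv] at h1
    refine ⟨h1.1, h.norm_le, h1.2.2, fun i hi p => ?_⟩
    rw [norm_iteratedFDeriv_fderiv]
    exact h.2 _ (by omega) p
  · rintro ⟨hd, hb, h⟩
    refine ⟨?_, fun i hi p => ?_⟩
    · push_cast
      rw [contDiff_succ_iff_fderiv]
      exact ⟨hd, by simp, h.1⟩
    · rcases i with _ | i
      · simpa using hb p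
      · rw [← norm_iteratedFDeriv_fderiv]
        exact h.2 _ (by omega) p

lemma BddC.mono {m : ℕ} {f : Spt → F} {A B : ℝ} (h : BddC m f A) (hAB : A ≤ B) : BddC m f B :=
  ⟨h.1, fun i hi p => (h.2 i hi p).trans hAB⟩

lemma exists_bddC_of_hasCompactSupport {m : ℕ} {f : Spt → F} (hf : ContDiff ℝ m f)
    (hc : HasCompactSupport f) : ∃ A, BddC m f A := by
  have : ∀ i ≤ m, ∃ A, 0 ≤ A ∧ ∀ p, ‖iteratedFDeriv ℝ i f p‖ ≤ A := by
    intro i hi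
    obtain ⟨A, hA⟩ := (hf.continuous_iteratedFDeriv (m := i) (by exact_mod_cast hi)).bounded_above_of_compact_support
      (hc.iteratedFDeriv i)
    exact ⟨A, (norm_nonneg _).trans (hA 0), hA⟩
  choose! A hA0 hA using this
  refine ⟨∑ i ∈ Finset.range (m + 1), A i, hf, fun i hi p => (hA i hi p).trans ?_⟩
  exact Finset.single_le_sum (f := A) (fun j hj => hA0 j (by simpa [Nat.lt_succ_iff] using hj))
    (Finset.mem_range.2 (Nat.lt_succ_of_le hi))

lemma BddC.mul {m : ℕ} {f g : Spt → ℝ} {A B : ℝ} (hf : BddC m f A) (hg : BddC m g B) :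
    BddC m (fun p => f p * g p) (2 ^ m * A * B) := by
  refine ⟨hf.1.mul hg.1, fun i hi p => ?_⟩
  refine (norm_iteratedFDeriv_mul_le hf.1 hg.1 p (n := i) (by exact_mod_cast hi)).trans ?_
  have hA := hf.nonneg
  have hB := hg.nonneg
  calc ∑ j ∈ Finset.range (i + 1), (i.choose j : ℝ) * ‖iteratedFDeriv ℝ j f p‖
        * ‖iteratedFDeriv ℝ (i - j) g p‖
      ≤ ∑ j ∈ Finset.range (i + 1), (i.choose j : ℝ) * A * B := by
        refine Finset.sum_le_sum fun j hj => ?_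
        have hj' : j < i + 1 := Finset.mem_range.1 hj
        gcongr
        · exact hf.2 j (by omega) p
        · exact hg.2 _ (by omega) p
    _ = 2 ^ i * A * B := by
        rw [← Finset.sum_mul, ← Finset.sum_mul]
        congr 2
        exact_mod_cast Nat.sum_range_choose i
    _ ≤ 2 ^ m * A * B := by
        gcongr
        norm_num

lemma BddC.lipschitzWith {m : ℕ} {f : Spt → F} {A : ℝ} (hf : BddC (m + 1) f A) :
    LipschitzWith A.toNNReal f := by
  rw [bddC_succ] at hf
  refine lipschitzWith_of_nnnorm_fderiv_le hf.1 fun p => ?_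
  rw [← NNReal.coe_le_coe, coe_nnnorm, Real.coe_toNNReal _ hf.2.2.nonneg]
  exact hf.2.2.norm_le p

lemma BddC.retConv {m : ℕ} {k : E3 → ℝ} (hk : Integrable k) {f : Spt → F} {A : ℝ}
    (hf : BddC m f A) : BddC m (retConv k f) ((∫ y, ‖k y‖) * A) := by
  induction m generalizing F with
  | zero =>
    rw [bddC_zero] at hf ⊢
    exact ⟨continuous_retConv hk hf.1.stronglyMeasurable hf.2 fun p _ => hf.1.continuousAt,
      norm_retConv_le hk hf.2⟩
  | succ m ih =>
    have hL := hf.lipschitzWith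
    rw [bddC_succ] at hf ⊢
    have hd : ∀ p, HasFDerivAt (_root_.retConv k f) (_root_.retConv k (fderiv ℝ f) p) p :=
      hasFDerivAt_retConv hk hL hf.2.1 hf.2.2.1.continuous.stronglyMeasurable
        fun p _ => (hf.1 p).hasFDerivAt
    refine ⟨fun p => (hd p).differentiableAt, norm_retConv_le hk hf.2.1, ?_⟩
    rw [show fderiv ℝ (_root_.retConv k f) = _root_.retConv k (fderiv ℝ f) from
      funext fun p => (hd p).fderiv]
    exact ih hf.2.2

lemma BddC.tsum [CompleteSpace F] {m : ℕ} {f : ℕ → Spt → F} {A : ℕ → ℝ}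
    (hf : ∀ n, BddC m (f n) (A n)) (hA : Summable A) :
    ContDiff ℝ m (fun p => ∑' n, f n p) ∧ BddC m (fun p => ∑' n, f n p) (∑' n, A n) := by
  have hc : ContDiff ℝ m (fun p => ∑' n, f n p) :=
    contDiff_tsum (v := fun _ => A) (fun n => (hf n).1) (fun _ _ => hA)
      fun i n p hi => (hf n).2 i (by exact_mod_cast hi) p
  refine ⟨hc, hc, fun i hi p => ?_⟩
  rw [iteratedFDeriv_tsum_apply (v := fun _ => A) (N := m) (fun n => (hf n).1) (fun _ _ => hA)
      (fun i n p hi => (hf n).2 i (by exact_mod_cast hi) p) (by exact_mod_cast hi)]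
  exact tsum_of_norm_bounded hA.hasSum fun n => (hf n).2 i hi p

end BddC

/-- The Lorentz form `t² - |x|²`. -/
def lor (p : Spt) : ℝ := p.2 ^ 2 - ‖p.1‖ ^ 2

lemma contDiff_lor {n : WithTop ℕ∞} : ContDiff ℝ n lor :=
  (contDiff_snd.pow 2).sub ((contDiff_norm_sq ℝ).comp contDiff_fst)

section conePow
variable {F : Type} [NormedAddCommGroup F] [NormedSpace ℝ F]

/-- `γ^k b` inside the open solid cone and `0` outside, `γ` being the Lorentz form. -/
def conePow (k : ℕ) (b : Spt → F) : Spt → F :=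
  indicator {p | ‖p.1‖ < p.2} fun p => lor p ^ k • b p

/-- The coefficient of `γ^k` in the derivative of `γ^(k+1) b`. -/
def conePowDeriv (k : ℕ) (b : Spt → F) (p : Spt) : Spt →L[ℝ] F :=
  (k + 1 : ℝ) • (fderiv ℝ lor p).smulRight (b p) + lor p • fderiv ℝ b p

lemma conePow_of_lt {k : ℕ} {b : Spt → F} {p : Spt} (hp : ‖p.1‖ < p.2) :
    conePow k b p = lor p ^ k • b p := indicator_of_mem (s := {p : Spt | ‖p.1‖ < p.2}) hp _

lemma conePow_of_le {k : ℕ} {b : Spt → F} {p : Spt} (hp : p.2 ≤ ‖p.1‖) :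
    conePow k b p = 0 := indicator_of_notMem (s := {p : Spt | ‖p.1‖ < p.2}) (not_lt.2 hp) _

lemma isOpen_cone : IsOpen {p : Spt | ‖p.1‖ < p.2} := isOpen_lt (by fun_prop) (by fun_prop)

lemma conePow_eventuallyEq {k : ℕ} {b : Spt → F} {p : Spt} (hp : ‖p.1‖ < p.2) :
    conePow k b =ᶠ[nhds p] fun p => lor p ^ k • b p := by
  filter_upwards [isOpen_cone.mem_nhds hp] with q hq using conePow_of_lt hq

lemma conePow_eventuallyEq_zero {k : ℕ} {b : Spt → F} {p : Spt} (hp : p.2 < ‖p.1‖) :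
    conePow k b =ᶠ[nhds p] fun _ => 0 := by
  have : IsOpen {p : Spt | p.2 < ‖p.1‖} := isOpen_lt (by fun_prop) (by fun_prop)
  filter_upwards [this.mem_nhds hp] with q hq using conePow_of_le (le_of_lt hq)

lemma stronglyMeasurable_conePow (k : ℕ) {b : Spt → F} (hb : Continuous b) :
    StronglyMeasurable (conePow k b) :=
  ((contDiff_lor (n := 0)).continuous.pow k |>.smul hb).stronglyMeasurable.indicator
    isOpen_cone.measurableSet

lemma continuousAt_conePow {k : ℕ} {b : Spt → F} (hb : Continuous b) {p : Spt}
    (hp : ‖p.1‖ ≠ p.2) : ContinuousAt (conePow k b) p := by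
  rcases hp.lt_or_gt with h | h
  · exact (((contDiff_lor (n := 0)).continuous.pow k).smul hb).continuousAt.congr
      (conePow_eventuallyEq h).symm
  · exact continuousAt_const.congr (conePow_eventuallyEq_zero h).symm

lemma hasFDerivAt_conePow {k : ℕ} {b : Spt → F} (hb : Differentiable ℝ b) {p : Spt}
    (hp : ‖p.1‖ ≠ p.2) :
    HasFDerivAt (conePow (k + 1) b) (conePow k (conePowDeriv k b) p) p := by
  rcases hp.lt_or_gt with h | h
  · rw [conePow_of_lt h]
    have h1 : HasFDerivAt lor (fderiv ℝ lor p) p :=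
      ((contDiff_lor (n := 1)).differentiable one_ne_zero p).hasFDerivAt
    have h2 := (h1.pow (k + 1)).smul (hb p).hasFDerivAt
    refine (h2.congr_of_eventuallyEq (conePow_eventuallyEq h)).congr_fderiv ?_
    refine ContinuousLinearMap.ext fun v => ?_
    simp [conePowDeriv, smul_smul, pow_succ]
    module
  · rw [conePow_of_le h.le]
    exact (hasFDerivAt_const _ _).congr_of_eventuallyEq (conePow_eventuallyEq_zero h)

lemma exists_norm_conePow_le (k : ℕ) {b : Spt → F} (hb : Continuous b) (hc : HasCompactSupport b) :
    ∃ C, ∀ p, ‖conePow k b p‖ ≤ C := by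
  obtain ⟨C, hC⟩ := (((contDiff_lor (n := 0)).continuous.pow k).smul
    hb).bounded_above_of_compact_support (hc.smul_left (f := fun p => lor p ^ k))
  refine ⟨C, fun p => ?_⟩
  exact (norm_indicator_le_norm_self _ _).trans (hC p)

lemma hasCompactSupport_conePow (k : ℕ) {b : Spt → F} (hc : HasCompactSupport b) :
    HasCompactSupport (conePow k b) := by
  refine hc.mono fun p hp hb => hp ?_
  simp [conePow, indicator, hb]

lemma exists_lipschitzWith_conePow (k : ℕ) {b : Spt → F} (hb : ContDiff ℝ 1 b)
    (hc : HasCompactSupport b) : ∃ K, LipschitzWith K (conePow (k + 1) b) := by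
  refine LocallyLipschitz.exists_lipschitzWith_of_hasCompactSupport ?_
    (hasCompactSupport_conePow _ hc)
  have h1 : LocallyLipschitz fun z : ℝ × ℝ × Spt => (z.1 * z.2.1) ^ (k + 1) • b z.2.2 := by
    refine ContDiff.locallyLipschitz (𝕂 := ℝ) ?_
    have hb' := hb.comp (contDiff_snd.comp contDiff_snd : ContDiff ℝ 1 fun z : ℝ × ℝ × Spt => z.2.2)
    exact ContDiff.smul (by fun_prop) hb'
  have hn : LipschitzWith 1 fun p : Spt => ‖p.1‖ := by
    have := (lipschitzWith_one_norm (E := E3)).comp (LipschitzWith.prod_fst (β := ℝ))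
    rwa [one_mul] at this
  have hs : LipschitzWith 1 fun p : Spt => p.2 := LipschitzWith.prod_snd
  have h2 : LocallyLipschitz fun p : Spt => (max (p.2 - ‖p.1‖) 0, p.2 + ‖p.1‖, p) :=
    ((hs.sub hn).max_const 0).locallyLipschitz.prodMk
      ((hs.add hn).locallyLipschitz.prodMk LocallyLipschitz.id)
  refine Eq.subst (motive := fun f => LocallyLipschitz f) ?_ (h1.comp h2)
  funext p
  symm
  by_cases hp : ‖p.1‖ < p.2
  · rw [conePow_of_lt hp, Function.comp_apply, max_eq_left (by linarith)]
    congr 2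
    rw [lor]; ring
  · rw [conePow_of_le (not_lt.1 hp), Function.comp_apply, max_eq_right (by linarith [not_lt.1 hp])]
    simp

lemma hasCompactSupport_conePowDeriv (k : ℕ) {b : Spt → F} (hc : HasCompactSupport b) :
    HasCompactSupport (conePowDeriv k b) := by
  refine hc.mono' fun p hp => ?_
  by_contra h
  refine hp ?_
  have h1 : b p = 0 := image_eq_zero_of_notMem_tsupport h
  have h2 : fderiv ℝ b p = 0 := by
    by_contra h3
    exact h (support_fderiv_subset ℝ h3)
  simp [conePowDeriv, h1, h2]

lemma contDiff_conePowDeriv (k : ℕ) {m : ℕ} {b : Spt → F} (hb : ContDiff ℝ (m + 1) b) :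
    ContDiff ℝ m (conePowDeriv k b) := by
  have h1 : ContDiff ℝ m (fderiv ℝ lor) := (contDiff_lor (n := m + 1)).fderiv_right le_rfl
  have h2 : ContDiff ℝ m (fderiv ℝ b) := hb.fderiv_right le_rfl
  have h3 : ContDiff ℝ m fun p => (fderiv ℝ lor p).smulRight (b p) :=
    h1.smulRight (hb.of_le (by simp))
  have h4 : ContDiff ℝ m fun p => lor p • fderiv ℝ b p := contDiff_lor.smul h2
  exact (h3.const_smul (k + 1 : ℝ)).add h4

lemma exists_bddC_retConv_conePow {κ : E3 → ℝ} (hκ : Integrable κ) (m : ℕ) {b : Spt → F}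
    (hb : ContDiff ℝ m b) (hc : HasCompactSupport b) :
    ∃ A, BddC m (retConv κ (conePow m b)) A := by
  induction m generalizing F with
  | zero =>
    obtain ⟨C, hC⟩ := exists_norm_conePow_le 0 hb.continuous hc
    exact ⟨_, bddC_zero.2 ⟨continuous_retConv hκ (stronglyMeasurable_conePow 0 hb.continuous) hC
      fun p hp => continuousAt_conePow hb.continuous hp, norm_retConv_le hκ hC⟩⟩
  | succ m ih =>
    push_cast at hb
    obtain ⟨C, hC⟩ := exists_norm_conePow_le (m + 1) hb.continuous hc
    obtain ⟨K, hK⟩ := exists_lipschitzWith_conePow m (hb.of_le (by simp)) hc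
    have hb' := contDiff_conePowDeriv m hb
    have hd : ∀ p, HasFDerivAt (retConv κ (conePow (m + 1) b))
        (retConv κ (conePow m (conePowDeriv m b)) p) p :=
      hasFDerivAt_retConv hκ hK hC (stronglyMeasurable_conePow m hb'.continuous) fun p hp =>
        hasFDerivAt_conePow (hb.differentiable (by simp)) hp
    obtain ⟨A, hA⟩ := ih hb' (hasCompactSupport_conePowDeriv m hc)
    refine ⟨max A ((∫ y, ‖κ y‖) * C), bddC_succ.2 ⟨fun p => (hd p).differentiableAt,
      fun p => (norm_retConv_le hκ hC p).trans (le_max_right _ _), ?_⟩⟩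
    rw [show fderiv ℝ (retConv κ (conePow (m + 1) b)) = retConv κ (conePow m (conePowDeriv m b))
      from funext fun p => (hd p).fderiv]
    exact hA.mono (le_max_left _ _)

end conePow

lemma integrable_lineDeriv_and_integral_eq_zero {W : E3 → ℝ} (hW : LocallyLipschitz W)
    (hc : HasCompactSupport W) (v : E3) :
    Integrable (fun y => lineDeriv ℝ W y v) ∧ ∫ y, lineDeriv ℝ W y v = 0 := by
  obtain ⟨K, hK⟩ := hW.exists_lipschitzWith_of_hasCompactSupport hc
  constructor
  · have hi : Integrable ((tsupport W).indicator fun _ => (K : ℝ) * ‖v‖) :=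
      (integrable_indicator_iff (isClosed_tsupport W).measurableSet).2
        (integrableOn_const (hs := hc.isCompact.measure_lt_top.ne))
    refine hi.mono' (measurable_lineDeriv hW.continuous).aestronglyMeasurable
      (ae_of_all _ fun y => ?_)
    by_cases hy : y ∈ tsupport W
    · rw [indicator_of_mem hy]
      exact norm_lineDeriv_le_of_lipschitz ℝ hK
    · rw [indicator_of_notMem hy]
      have : W =ᶠ[nhds y] fun _ => 0 := by
        filter_upwards [(isClosed_tsupport W).isOpen_compl.mem_nhds hy] with z hz
          using image_eq_zero_of_notMem_tsupport hz
      rw [this.lineDeriv_eq]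
      simp [lineDeriv]
  · have h := (LipschitzWith.const (1:ℝ) : LipschitzWith 0 fun _ : E3 => (1:ℝ)).integral_lineDeriv_mul_eq
      (μ := volume) hK hc v
    simp only [lineDeriv_neg, mul_one, integral_neg] at h
    have h0 : ∀ y : E3, lineDeriv ℝ (fun _ : E3 => (1:ℝ)) y v = 0 := fun y => by simp [lineDeriv]
    simp only [h0, zero_mul, integral_zero] at h
    linarith

/-- A smooth cutoff equal to `0` on `(-∞, 1]` and to `1` on `[2, ∞)`. -/
def originCut (s : ℝ) : ℝ := smoothTransition (s - 1)

lemma contDiff_originCut {n : ℕ∞} : ContDiff ℝ n originCut :=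
  smoothTransition.contDiff.comp (by fun_prop)

lemma originCut_of_le {s : ℝ} (hs : s ≤ 1) : originCut s = 0 :=
  smoothTransition.zero_of_nonpos (by linarith)

lemma originCut_of_ge {s : ℝ} (hs : 2 ≤ s) : originCut s = 1 :=
  smoothTransition.one_of_one_le (by linarith)

lemma monotone_originCut : Monotone originCut := fun _ _ h =>
  smoothTransition.monotone (by linarith)

lemma abs_originCut_le (s : ℝ) : |originCut s| ≤ 1 := by
  rw [originCut, abs_of_nonneg (smoothTransition.nonneg _)]
  exact smoothTransition.le_one _

lemma deriv_originCut_nonneg (s : ℝ) : 0 ≤ deriv originCut s := monotone_originCut.deriv_nonneg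

lemma deriv_originCut_of_lt {s : ℝ} (hs : s < 1) : deriv originCut s = 0 := by
  have : originCut =ᶠ[nhds s] fun _ => 0 := by
    filter_upwards [Iio_mem_nhds hs] with z hz using originCut_of_le (le_of_lt hz)
  rw [this.deriv_eq]; simp

lemma deriv_originCut_of_gt {s : ℝ} (hs : 2 < s) : deriv originCut s = 0 := by
  have : originCut =ᶠ[nhds s] fun _ => 1 := by
    filter_upwards [Ioi_mem_nhds hs] with z hz using originCut_of_ge (le_of_lt hz)
  rw [this.deriv_eq]; simp

lemma hasDerivAt_originCut (s : ℝ) : HasDerivAt originCut (deriv originCut s) s :=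
  ((contDiff_originCut (n := 1)).differentiable one_ne_zero s).hasDerivAt

lemma continuous_deriv_originCut : Continuous (deriv originCut) :=
  (contDiff_originCut (n := 1)).continuous_deriv le_rfl

lemma contDiff_originCut_div {ε : ℝ} (hε : 0 < ε) (j : ℕ) :
    ContDiff ℝ 1 fun y : E3 => originCut (‖y‖ / ε) / ‖y‖ ^ j := by
  rw [contDiff_iff_contDiffAt]
  intro y
  by_cases hy : y = 0
  · have : (fun y : E3 => originCut (‖y‖ / ε) / ‖y‖ ^ j) =ᶠ[nhds y] fun _ => 0 := by
      filter_upwards [ball_mem_nhds y hε] with z hz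
      rw [hy, mem_ball_zero_iff] at hz
      rw [originCut_of_le ((div_le_one hε).2 hz.le), zero_div]
    exact contDiffAt_const.congr_of_eventuallyEq this
  · have h1 : ContDiffAt ℝ 1 (fun y : E3 => ‖y‖) y := contDiffAt_norm ℝ hy
    have h2 : ContDiffAt ℝ 1 (fun y : E3 => originCut (‖y‖ / ε)) y :=
      (contDiff_originCut (n := 1)).contDiffAt.comp y (h1.div_const ε)
    exact h2.div (h1.pow j) (pow_ne_zero _ (norm_ne_zero_iff.2 hy))

/-- The past light cone with vertex `p`, parametrised by `ℝ³`. -/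
def pastCone (p : Spt) (y : E3) : Spt := p - (y, ‖y‖)

/-- The wave operator as a function of the second derivative. -/
def boxL (B : Spt →L[ℝ] Spt →L[ℝ] ℝ) : ℝ :=
  B (0, 1) (0, 1) - ∑ i, B (basis3 i, 0) (basis3 i, 0)

/-- The vector field on the past light cone whose divergence is `□f / |y|`. -/
def kirchField (ε : ℝ) (f : Spt → ℝ) (D : Spt → Spt →L[ℝ] ℝ) (p : Spt) (i : Fin 3) (y : E3) : ℝ :=
  originCut (‖y‖ / ε) / ‖y‖ ^ 1 * D (pastCone p y) (basis3 i, 0)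
    - originCut (‖y‖ / ε) / ‖y‖ ^ 2 * y i * D (pastCone p y) (0, 1)
    - originCut (‖y‖ / ε) / ‖y‖ ^ 3 * y i * f (pastCone p y)

lemma locallyLipschitz_kirchField {ε : ℝ} (hε : 0 < ε) {f : Spt → ℝ} {D : Spt → Spt →L[ℝ] ℝ}
    {p : Spt} (hf : LocallyLipschitz fun y => f (pastCone p y))
    (hD : LocallyLipschitz fun y => D (pastCone p y)) (i : Fin 3) :
    LocallyLipschitz (kirchField ε f D p i) := by
  have h1 : LocallyLipschitz fun z : E3 × ℝ × (Spt →L[ℝ] ℝ) =>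
      originCut (‖z.1‖ / ε) / ‖z.1‖ ^ 1 * z.2.2 (basis3 i, 0)
      - originCut (‖z.1‖ / ε) / ‖z.1‖ ^ 2 * z.1 i * z.2.2 (0, 1)
      - originCut (‖z.1‖ / ε) / ‖z.1‖ ^ 3 * z.1 i * z.2.1 := by
    refine ContDiff.locallyLipschitz (𝕂 := ℝ) ?_
    have ha : ∀ j, ContDiff ℝ 1 fun z : E3 × ℝ × (Spt →L[ℝ] ℝ) =>
        originCut (‖z.1‖ / ε) / ‖z.1‖ ^ j := fun j =>
      (contDiff_originCut_div hε j).comp contDiff_fst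
    have hi : ContDiff ℝ 1 fun z : E3 × ℝ × (Spt →L[ℝ] ℝ) => z.1 i :=
      (EuclideanSpace.proj i : E3 →L[ℝ] ℝ).contDiff.comp contDiff_fst
    have hL : ∀ v : Spt, ContDiff ℝ 1 fun z : E3 × ℝ × (Spt →L[ℝ] ℝ) => z.2.2 v := fun v =>
      (contDiff_snd.comp contDiff_snd).clm_apply contDiff_const
    have hf : ContDiff ℝ 1 fun z : E3 × ℝ × (Spt →L[ℝ] ℝ) => z.2.1 :=
      contDiff_fst.comp contDiff_snd
    have h1 := (ha 1).mul (hL (basis3 i, 0))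
    have h2 := ((ha 2).mul hi).mul (hL (0, 1))
    have h3 := ((ha 3).mul hi).mul hf
    exact (h1.sub h2).sub h3
  have h2 : LocallyLipschitz fun y : E3 => (y, f (pastCone p y), D (pastCone p y)) :=
    LocallyLipschitz.id.prodMk (hf.prodMk hD)
  have h3 := h1.comp h2
  unfold kirchField
  exact h3

lemma hasDerivAt_norm_line {y : E3} (hy : y ≠ 0) (i : Fin 3) :
    HasDerivAt (fun s : ℝ => ‖y + s • basis3 i‖) (y i / ‖y‖) 0 := by
  have h1 : HasDerivAt (fun s : ℝ => y + s • basis3 i) (basis3 i) 0 := by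
    simpa using ((hasDerivAt_id (0:ℝ)).smul_const (basis3 i)).const_add y
  have h2 := (h1.norm_sq).sqrt (by simpa using hy)
  simp only [zero_smul, add_zero, Real.sqrt_sq (norm_nonneg _)] at h2
  refine h2.congr_deriv ?_
  have : inner ℝ y (basis3 i) = y i := by
    rw [basis3, EuclideanSpace.inner_single_right]; simp
  rw [this]
  ring

lemma hasDerivAt_pastCone_line (p : Spt) {y : E3} (hy : y ≠ 0) (i : Fin 3) :
    HasDerivAt (fun s : ℝ => pastCone p (y + s • basis3 i))
      (-((basis3 i, 0) + (y i / ‖y‖) • (0, 1) : Spt)) 0 := by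
  have h1 : HasDerivAt (fun s : ℝ => y + s • basis3 i) (basis3 i) 0 := by
    simpa using ((hasDerivAt_id (0:ℝ)).smul_const (basis3 i)).const_add y
  have h2 := (h1.prodMk (hasDerivAt_norm_line hy i)).const_sub p
  refine h2.congr_deriv ?_
  simp

lemma hasLineDerivAt_kirchField {ε : ℝ} (hε : 0 < ε) {f : Spt → ℝ} {D : Spt → Spt →L[ℝ] ℝ}
    {p : Spt} {B : Spt →L[ℝ] Spt →L[ℝ] ℝ} {y : E3} (hy : y ≠ 0)
    (hf : HasFDerivAt f (D (pastCone p y)) (pastCone p y))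
    (hD : HasFDerivAt D B (pastCone p y)) (i : Fin 3) :
    HasLineDerivAt ℝ (kirchField ε f D p i)
      (deriv originCut (‖y‖ / ε) * (y i / ‖y‖ / ε) *
          (D (pastCone p y) (basis3 i, 0) / ‖y‖ - y i * D (pastCone p y) (0, 1) / ‖y‖ ^ 2
            - y i * f (pastCone p y) / ‖y‖ ^ 3)
        + originCut (‖y‖ / ε) *
          (-(B (basis3 i, 0) (basis3 i, 0) + y i / ‖y‖ * B (0, 1) (basis3 i, 0)) / ‖y‖
            - D (pastCone p y) (basis3 i, 0) * y i / ‖y‖ ^ 3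
            - D (pastCone p y) (0, 1) / ‖y‖ ^ 2
            + y i * (B (basis3 i, 0) (0, 1) + y i / ‖y‖ * B (0, 1) (0, 1)) / ‖y‖ ^ 2
            + 2 * y i ^ 2 * D (pastCone p y) (0, 1) / ‖y‖ ^ 4
            - f (pastCone p y) / ‖y‖ ^ 3
            + y i * (D (pastCone p y) (basis3 i, 0) + y i / ‖y‖ * D (pastCone p y) (0, 1)) / ‖y‖ ^ 3
            + 3 * y i ^ 2 * f (pastCone p y) / ‖y‖ ^ 5)) y (basis3 i) := by
  have hr : ‖y‖ ≠ 0 := norm_ne_zero_iff.2 hy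
  have hP := hasDerivAt_pastCone_line p hy i
  have hn := hasDerivAt_norm_line hy i
  have hP0 : pastCone p (y + (0:ℝ) • basis3 i) = pastCone p y := by simp
  have hf1 : HasDerivAt (fun s : ℝ => f (pastCone p (y + s • basis3 i))) _ 0 :=
    HasFDerivAt.comp_hasDerivAt (0:ℝ) (by rw [hP0]; exact hf) hP
  have hD1 : HasDerivAt (fun s : ℝ => D (pastCone p (y + s • basis3 i))) _ 0 :=
    HasFDerivAt.comp_hasDerivAt (0:ℝ) (by rw [hP0]; exact hD) hP
  have hDe := hD1.clm_apply (hasDerivAt_const (0:ℝ) ((basis3 i, 0) : Spt))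
  have hDt := hD1.clm_apply (hasDerivAt_const (0:ℝ) ((0, 1) : Spt))
  have hyi : HasDerivAt (fun s : ℝ => (y + s • basis3 i) i) 1 0 := by
    have : (fun s : ℝ => (y + s • basis3 i) i) = fun s => y i + s := by
      funext s; simp [basis3]
    rw [this]
    exact (hasDerivAt_id (0:ℝ)).const_add _
  have hcut : HasDerivAt (fun s : ℝ => originCut (‖y + s • basis3 i‖ / ε))
      (deriv originCut (‖y‖ / ε) * (y i / ‖y‖ / ε)) 0 := by
    have h := hasDerivAt_originCut (‖y + (0:ℝ) • basis3 i‖ / ε)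
    have h' := h.comp (0:ℝ) (hn.div_const ε)
    rw [zero_smul, add_zero] at h'
    exact h'
  have hq : ∀ j : ℕ, HasDerivAt (fun s : ℝ => originCut (‖y + s • basis3 i‖ / ε) /
      ‖y + s • basis3 i‖ ^ j) _ 0 := fun j =>
    hcut.div (hn.pow j) (by simpa using pow_ne_zero j hr)
  have main := (((hq 1).mul hDe).sub (((hq 2).mul hyi).mul hDt)).sub (((hq 3).mul hyi).mul hf1)
  unfold HasLineDerivAt
  refine main.congr_deriv ?_
  simp only [zero_smul, add_zero, Pi.mul_apply, map_neg, map_add, map_smul,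
    neg_apply, add_apply, smul_apply,
    smul_eq_mul, map_zero]
  field_simp
  ring

/-- The constant in Kirchhoff's formula. -/
def kirchConst : ℝ := ∫ z : E3, deriv originCut ‖z‖ / ‖z‖ ^ 2

lemma kirchConst_pos : 0 < kirchConst := by
  obtain ⟨s, hs, hs'⟩ : ∃ s ∈ Ioo (1:ℝ) 2, deriv originCut s = 1 := by
    obtain ⟨s, hs, h⟩ := exists_deriv_eq_slope originCut (one_lt_two : (1:ℝ) < 2)
      (contDiff_originCut (n := 1)).continuous.continuousOn
      ((contDiff_originCut (n := 1)).differentiable one_ne_zero).differentiableOn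
    refine ⟨s, hs, ?_⟩
    rw [h, originCut_of_ge le_rfl, originCut_of_le le_rfl]; norm_num
  have hcont : Continuous fun z : E3 => deriv originCut ‖z‖ / ‖z‖ ^ 2 := by
    rw [continuous_iff_continuousAt]
    intro z
    by_cases hz : z = 0
    · have : (fun z : E3 => deriv originCut ‖z‖ / ‖z‖ ^ 2) =ᶠ[nhds z] fun _ => 0 := by
        filter_upwards [ball_mem_nhds z one_pos] with y hy
        rw [hz, mem_ball_zero_iff] at hy
        rw [deriv_originCut_of_lt hy, zero_div]
      exact continuousAt_const.congr this.symm
    · exact (continuous_deriv_originCut.comp continuous_norm).continuousAt.div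
        (by fun_prop) (pow_ne_zero _ (norm_ne_zero_iff.2 hz))
  refine hcont.integral_pos_of_hasCompactSupport_nonneg_nonzero (x := s • basis3 0) ?_ ?_ ?_
  · refine HasCompactSupport.of_support_subset_isCompact (isCompact_closedBall (0:E3) 2) ?_
    intro z hz
    by_contra h
    rw [mem_closedBall_zero_iff, not_le] at h
    exact hz (by simp only [deriv_originCut_of_gt h, zero_div])
  · intro z
    exact div_nonneg (deriv_originCut_nonneg _) (by positivity)
  · have : ‖s • basis3 0‖ = s := by
      rw [norm_smul, basis3, PiLp.norm_single]
      simp [abs_of_pos (zero_lt_one.trans hs.1)]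
    simp only [this, hs']
    have := zero_lt_one.trans hs.1
    positivity

lemma norm_inv_integrableOn (R : ℝ) :
    Integrable fun y : E3 => (closedBall (0:E3) R).indicator (fun y => ‖y‖⁻¹) y := by
  have h : (fun y : E3 => (closedBall (0:E3) R).indicator (fun y => ‖y‖⁻¹) y)
      = fun y : E3 => ((Iic R).indicator (fun r : ℝ => r⁻¹)) ‖y‖ := by
    funext y
    by_cases hy : ‖y‖ ≤ R
    · rw [indicator_of_mem (by simpa using hy), indicator_of_mem (by simpa using hy)]
    · rw [indicator_of_notMem (by simpa using hy), indicator_of_notMem (by simpa using hy)]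
  rw [h, integrable_fun_norm_addHaar]
  have hfin : Module.finrank ℝ E3 - 1 = 2 := by simp
  rw [hfin]
  have h2 : IntegrableOn (fun r : ℝ => r) (Ioc 0 R) :=
    (continuous_id.integrableOn_Icc).mono_set Ioc_subset_Icc_self
  have h3 : Integrable ((Ioc 0 R).indicator fun r : ℝ => r) :=
    (integrable_indicator_iff measurableSet_Ioc).2 h2
  refine (h3.integrableOn (s := Ioi 0)).congr_fun (fun r hr => ?_) measurableSet_Ioi
  have hr0 : (0:ℝ) < r := hr
  by_cases hR : r ≤ R
  · have hm : r ∈ Ioc 0 R := ⟨hr0, hR⟩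
    rw [indicator_of_mem hm]
    simp only [smul_eq_mul]
    rw [indicator_of_mem (by simpa using hR)]
    field_simp
  · have hm : r ∉ Ioc 0 R := fun h => hR h.2
    rw [indicator_of_notMem hm]
    simp only [smul_eq_mul]
    rw [indicator_of_notMem (by simpa using hR), mul_zero]

lemma norm_boxL_le (B : Spt →L[ℝ] Spt →L[ℝ] ℝ) : ‖boxL B‖ ≤ 4 * ‖B‖ := by
  have h : ∀ v : Spt, ‖v‖ ≤ 1 → ‖B v v‖ ≤ ‖B‖ := fun v hv => by
    refine (B.le_opNorm₂ v v).trans ?_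
    have := norm_nonneg v
    have := norm_nonneg B
    calc ‖B‖ * ‖v‖ * ‖v‖ ≤ ‖B‖ * 1 * 1 := by gcongr
      _ = ‖B‖ := by ring
  have hb : ∀ i, ‖((basis3 i, 0) : Spt)‖ ≤ 1 := fun i => by
    simp [Prod.norm_def, basis3]
  have ht : ‖((0, 1) : Spt)‖ ≤ 1 := by simp [Prod.norm_def]
  unfold boxL
  refine (norm_sub_le _ _).trans ?_
  have := (norm_sum_le Finset.univ fun i => B (basis3 i, 0) (basis3 i, 0)).trans
    (Finset.sum_le_sum fun i _ => h _ (hb i))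
  simp only [Finset.sum_const, Finset.card_univ, Fintype.card_fin, nsmul_eq_mul] at this
  have := h _ ht
  push_cast at *
  linarith

lemma integral_kirch_eps {ε : ℝ} (hε : 0 < ε) {f : Spt → ℝ} {D : Spt → Spt →L[ℝ] ℝ}
    {H : Spt → Spt →L[ℝ] Spt →L[ℝ] ℝ} {p : Spt} {R C : ℝ}
    (hf : LocallyLipschitz fun y => f (pastCone p y))
    (hD : LocallyLipschitz fun y => D (pastCone p y))
    (hH : AEStronglyMeasurable (fun y => boxL (H (pastCone p y))))
    (hHC : ∀ y, ‖boxL (H (pastCone p y))‖ ≤ C)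
    (hfR : ∀ y, R < ‖y‖ → f (pastCone p y) = 0) (hDR : ∀ y, R < ‖y‖ → D (pastCone p y) = 0)
    (hHR : ∀ y, R < ‖y‖ → boxL (H (pastCone p y)) = 0)
    (hd : ∀ᵐ y, (∀ᶠ q in nhds (pastCone p y), HasFDerivAt f (D q) q) ∧
      HasFDerivAt D (H (pastCone p y)) (pastCone p y)) :
    ∫ y, originCut (‖y‖ / ε) / ‖y‖ * boxL (H (pastCone p y)) =
      ∫ y : E3, deriv originCut (‖y‖ / ε) / ε * (f (pastCone p y) / ‖y‖ ^ 2
        + D (pastCone p y) (0, 1) / ‖y‖ - D (pastCone p y) (y, 0) / ‖y‖ ^ 2) := by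
  have hsupp : ∀ i, HasCompactSupport (kirchField ε f D p i) := fun i => by
    refine HasCompactSupport.of_support_subset_isCompact (isCompact_closedBall (0:E3) R) ?_
    intro y hy
    by_contra h
    rw [mem_closedBall_zero_iff, not_le] at h
    exact hy (by simp [kirchField, hfR y h, hDR y h])
  have hint := fun i => integrable_lineDeriv_and_integral_eq_zero
    (locallyLipschitz_kirchField hε hf hD i) (hsupp i) (basis3 i)
  have hsum : Integrable (fun y => ∑ i, lineDeriv ℝ (kirchField ε f D p i) y (basis3 i)) :=
    integrable_finsetSum _ fun i _ => (hint i).1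
  have hzero : ∫ y, ∑ i, lineDeriv ℝ (kirchField ε f D p i) y (basis3 i) = 0 := by
    rw [integral_finsetSum _ fun i _ => (hint i).1]
    exact Finset.sum_eq_zero fun i _ => (hint i).2
  have hAint : Integrable fun y : E3 =>
      originCut (‖y‖ / ε) / ‖y‖ * boxL (H (pastCone p y)) := by
    refine ((norm_inv_integrableOn R).mul_const C).mono' ?_ (ae_of_all _ fun y => ?_)
    · refine AEStronglyMeasurable.mul ?_ hH
      have := (contDiff_originCut_div hε 1).continuous
      simpa using this.aestronglyMeasurable
    · by_cases hy : ‖y‖ ≤ R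
      · rw [indicator_of_mem (by simpa using hy), norm_mul, norm_div, norm_norm]
        have h1 : ‖originCut (‖y‖ / ε)‖ ≤ 1 := abs_originCut_le _
        have h2 := hHC y
        have hC0 : 0 ≤ C := (norm_nonneg _).trans h2
        rw [div_eq_mul_inv]
        have h3 : 0 ≤ ‖y‖⁻¹ := by positivity
        calc _ ≤ 1 * ‖y‖⁻¹ * C := by gcongr
          _ = _ := by ring
      · rw [hHR y (not_le.1 hy), indicator_of_notMem (by simpa using hy)]
        simp
  have hpt : ∀ᵐ y : E3, ∑ i, lineDeriv ℝ (kirchField ε f D p i) y (basis3 i) =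
      originCut (‖y‖ / ε) / ‖y‖ * boxL (H (pastCone p y)) -
        deriv originCut (‖y‖ / ε) / ε * (f (pastCone p y) / ‖y‖ ^ 2
          + D (pastCone p y) (0, 1) / ‖y‖ - D (pastCone p y) (y, 0) / ‖y‖ ^ 2) := by
    have hne : ∀ᵐ y : E3, y ≠ 0 := by simp [ae_iff]
    filter_upwards [hd, hne] with y hy hy0
    have hsymm := second_derivative_symmetric_of_eventually hy.1 hy.2
    rw [Finset.sum_congr rfl fun i _ =>
      (hasLineDerivAt_kirchField hε hy0 hy.1.self_of_nhds hy.2 i).lineDeriv]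
    have hr : ‖y‖ ≠ 0 := norm_ne_zero_iff.2 hy0
    have hr2 : ‖y‖ ^ 2 = y 0 ^ 2 + y 1 ^ 2 + y 2 ^ 2 := by
      rw [EuclideanSpace.norm_sq_eq, Fin.sum_univ_three]; simp
    have hdec : D (pastCone p y) (y, 0) = y 0 * D (pastCone p y) (basis3 0, 0)
        + y 1 * D (pastCone p y) (basis3 1, 0) + y 2 * D (pastCone p y) (basis3 2, 0) := by
      have : ((y, 0) : Spt) = y 0 • (basis3 0, 0) + y 1 • (basis3 1, 0) + y 2 • (basis3 2, 0) := by
        ext j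
        · fin_cases j <;> simp [basis3]
        · simp
      rw [this, map_add, map_add, map_smul, map_smul, map_smul]; rfl
    rw [hdec, boxL, Fin.sum_univ_three, Fin.sum_univ_three,
      hsymm (basis3 0, 0) (0, 1), hsymm (basis3 1, 0) (0, 1), hsymm (basis3 2, 0) (0, 1)]
    generalize H (pastCone p y) (0, 1) (0, 1) = Btt
    generalize D (pastCone p y) (0, 1) = Dt
    generalize f (pastCone p y) = F
    generalize originCut (‖y‖ / ε) = φ
    generalize deriv originCut (‖y‖ / ε) = φ'
    have hε' := hε.ne'
    generalize ‖y‖ = r at *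
    linear_combination (norm := skip) (-(φ * (Btt / r ^ 3 + 3 * Dt / r ^ 4 + 3 * F / r ^ 5)
      - φ' / ε * (Dt / r ^ 3 + F / r ^ 4))) * hr2
    field_simp
    ring
  have hBint : Integrable fun y : E3 => deriv originCut (‖y‖ / ε) / ε * (f (pastCone p y) / ‖y‖ ^ 2
        + D (pastCone p y) (0, 1) / ‖y‖ - D (pastCone p y) (y, 0) / ‖y‖ ^ 2) := by
    refine (hAint.sub hsum).congr ?_
    filter_upwards [hpt] with y hy
    simp only [Pi.sub_apply]
    rw [hy]; ring
  rw [integral_congr_ae hpt, integral_sub hAint hBint] at hzero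
  linarith

lemma exists_deriv_originCut_le : ∃ M, ∀ s, ‖deriv originCut s‖ ≤ M := by
  refine continuous_deriv_originCut.bounded_above_of_compact_support ?_
  refine HasCompactSupport.of_support_subset_isCompact (isCompact_Icc (a := (1:ℝ)) (b := 2)) ?_
  intro s hs
  by_contra h
  rw [mem_Icc, not_and_or, not_le, not_le] at h
  exact hs (h.elim deriv_originCut_of_lt deriv_originCut_of_gt)

lemma continuous_pastCone (p : Spt) : Continuous (pastCone p) := continuous_sub_cone p

lemma tendsto_kirch_boundary {f : Spt → ℝ} {D : Spt → Spt →L[ℝ] ℝ} {p : Spt} {Cf CD : ℝ}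
    (hf : Continuous fun y => f (pastCone p y)) (hD : Continuous fun y => D (pastCone p y))
    (hfC : ∀ y, ‖f (pastCone p y)‖ ≤ Cf) (hDC : ∀ y, ‖D (pastCone p y)‖ ≤ CD)
    {ε : ℕ → ℝ} (hε : ∀ n, 0 < ε n) (hε1 : ∀ n, ε n ≤ 1) (hε0 : Filter.Tendsto ε Filter.atTop (nhds 0)) :
    Filter.Tendsto (fun n => ∫ y : E3, deriv originCut (‖y‖ / ε n) / ε n *
      (f (pastCone p y) / ‖y‖ ^ 2 + D (pastCone p y) (0, 1) / ‖y‖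
        - D (pastCone p y) (y, 0) / ‖y‖ ^ 2)) Filter.atTop (nhds (kirchConst * f p)) := by
  obtain ⟨M, hM⟩ := exists_deriv_originCut_le
  have hM0 : 0 ≤ M := (norm_nonneg _).trans (hM 0)
  have hCf : 0 ≤ Cf := (norm_nonneg _).trans (hfC 0)
  have hCD : 0 ≤ CD := (norm_nonneg _).trans (hDC 0)
  have hscale : ∀ n, (∫ y : E3, deriv originCut (‖y‖ / ε n) / ε n *
      (f (pastCone p y) / ‖y‖ ^ 2 + D (pastCone p y) (0, 1) / ‖y‖
        - D (pastCone p y) (y, 0) / ‖y‖ ^ 2)) =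
      ∫ z : E3, deriv originCut ‖z‖ * (f (pastCone p (ε n • z)) / ‖z‖ ^ 2
        + ε n * (D (pastCone p (ε n • z)) (0, 1) / ‖z‖
          - D (pastCone p (ε n • z)) (z, 0) / ‖z‖ ^ 2)) := by
    intro n
    have h := Measure.integral_comp_smul (volume : Measure E3)
      (fun y : E3 => deriv originCut (‖y‖ / ε n) / ε n *
      (f (pastCone p y) / ‖y‖ ^ 2 + D (pastCone p y) (0, 1) / ‖y‖
        - D (pastCone p y) (y, 0) / ‖y‖ ^ 2)) (ε n)
    have hn := hε n
    have hfin : Module.finrank ℝ E3 = 3 := by simp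
    rw [hfin, abs_of_pos (by positivity), smul_eq_mul, eq_comm, inv_mul_eq_iff_eq_mul₀ (by positivity),
      ← integral_const_mul] at h
    rw [h]
    refine integral_congr_ae (ae_of_all _ fun z => ?_)
    simp only [norm_smul, Real.norm_eq_abs, abs_of_pos hn]
    have hz : ((ε n • z, 0) : Spt) = ε n • (z, 0) := by simp
    rw [hz, map_smul, smul_eq_mul, mul_div_cancel_left₀ _ hn.ne']
    by_cases hz0 : ‖z‖ = 0
    · rw [hz0, deriv_originCut_of_lt one_pos]; simp
    · field_simp
      ring
  simp only [hscale]
  have hlim : kirchConst * f p = ∫ z : E3, deriv originCut ‖z‖ / ‖z‖ ^ 2 * f p := by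
    rw [integral_mul_const]; rfl
  rw [hlim]
  refine tendsto_integral_of_dominated_convergence
    ((closedBall (0:E3) 2).indicator fun _ => M * (Cf + (CD + 2 * CD))) ?_ ?_ ?_ ?_
  · intro n
    have hsm : Continuous fun z : E3 => ε n • z := by fun_prop
    have h1 := hf.comp hsm
    have h2 := hD.comp hsm
    have h3 : Continuous fun z : E3 => D (pastCone p (ε n • z)) (0, 1) := h2.clm_apply continuous_const
    have h4 : Continuous fun z : E3 => D (pastCone p (ε n • z)) (z, 0) :=
      h2.clm_apply (by fun_prop)
    have h5 : Continuous fun z : E3 => deriv originCut ‖z‖ :=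
      continuous_deriv_originCut.comp continuous_norm
    exact (h5.measurable.mul ((h1.measurable.div (by fun_prop)).add
      (measurable_const.mul ((h3.measurable.div (by fun_prop)).sub
        (h4.measurable.div (by fun_prop)))))).aestronglyMeasurable
  · exact (integrable_indicator_iff measurableSet_closedBall).2
      (integrableOn_const (hs := measure_closedBall_lt_top.ne))
  · intro n
    refine ae_of_all _ fun z => ?_
    by_cases h1 : ‖z‖ < 1
    · rw [deriv_originCut_of_lt h1, zero_mul, norm_zero]
      exact indicator_nonneg (fun _ _ => by positivity) _
    by_cases h2 : 2 < ‖z‖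
    · rw [deriv_originCut_of_gt h2, zero_mul, norm_zero]
      exact indicator_nonneg (fun _ _ => by positivity) _
    rw [not_lt] at h1 h2
    rw [indicator_of_mem (by simpa using h2), norm_mul]
    refine mul_le_mul (hM _) ?_ (norm_nonneg _) hM0
    have hdiv : ∀ (a b : ℝ) (j : ℕ), |a| ≤ b → |a / ‖z‖ ^ j| ≤ b := fun a b j hab => by
      rw [abs_div, abs_of_nonneg (by positivity : 0 ≤ ‖z‖ ^ j)]
      exact (div_le_self (abs_nonneg _) (one_le_pow₀ h1)).trans hab
    have hDv : ∀ (v : Spt) (b : ℝ), ‖v‖ ≤ b → |D (pastCone p (ε n • z)) v| ≤ b * CD := fun v b hv => by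
      rw [mul_comm]
      refine ((D _).le_opNorm v).trans ?_
      exact mul_le_mul (hDC _) hv (norm_nonneg _) hCD
    refine (norm_add_le _ _).trans (add_le_add (hdiv _ _ 2 (hfC _)) ?_)
    rw [norm_mul, Real.norm_eq_abs, abs_of_pos (hε n)]
    refine (mul_le_of_le_one_left (norm_nonneg _) (hε1 n)).trans ?_
    refine (norm_sub_le _ _).trans (add_le_add ?_ ?_)
    · have := hdiv _ _ 1 (hDv (0, 1) 1 (by simp [Prod.norm_def]))
      rwa [pow_one, one_mul] at this
    · exact hdiv _ _ 2 (hDv (z, 0) 2 (by simpa [Prod.norm_def] using h2))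
  · refine ae_of_all _ fun z => ?_
    have hsm : Filter.Tendsto (fun n => ε n • z) Filter.atTop (nhds 0) := by
      simpa using hε0.smul_const z
    have hP : pastCone p 0 = p := by simp [pastCone]
    have h1 : Filter.Tendsto (fun n => f (pastCone p (ε n • z))) Filter.atTop (nhds (f p)) := by
      have := (hf.tendsto 0).comp hsm
      rwa [hP] at this
    have h2 : Filter.Tendsto (fun n => D (pastCone p (ε n • z))) Filter.atTop (nhds (D p)) := by
      have := (hD.tendsto 0).comp hsm
      rwa [hP] at this
    have h3 : ∀ v, Filter.Tendsto (fun n => D (pastCone p (ε n • z)) v) Filter.atTop (nhds (D p v)) :=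
      fun v => ((ContinuousLinearMap.apply ℝ ℝ v).continuous.tendsto _).comp h2
    have := ((h1.div_const (‖z‖ ^ 2)).add (hε0.mul (((h3 (0, 1)).div_const ‖z‖).sub
      ((h3 (z, 0)).div_const (‖z‖ ^ 2))))).const_mul (deriv originCut ‖z‖)
    convert this using 2
    ring

/-- Kirchhoff's formula. -/
theorem integral_boxL_pastCone {f : Spt → ℝ} {D : Spt → Spt →L[ℝ] ℝ}
    {H : Spt → Spt →L[ℝ] Spt →L[ℝ] ℝ} {p : Spt} {R C : ℝ}
    (hf : LocallyLipschitz fun y => f (pastCone p y))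
    (hD : LocallyLipschitz fun y => D (pastCone p y))
    (hH : AEStronglyMeasurable (fun y => boxL (H (pastCone p y))))
    (hHC : ∀ y, ‖boxL (H (pastCone p y))‖ ≤ C)
    (hfR : ∀ y, R < ‖y‖ → f (pastCone p y) = 0) (hDR : ∀ y, R < ‖y‖ → D (pastCone p y) = 0)
    (hHR : ∀ y, R < ‖y‖ → boxL (H (pastCone p y)) = 0)
    (hd : ∀ᵐ y, (∀ᶠ q in nhds (pastCone p y), HasFDerivAt f (D q) q) ∧
      HasFDerivAt D (H (pastCone p y)) (pastCone p y)) :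
    ∫ y : E3, ‖y‖⁻¹ * boxL (H (pastCone p y)) = kirchConst * f p := by
  set ε : ℕ → ℝ := fun n => 1 / ((n : ℝ) + 1) with hεdef
  have hε : ∀ n, 0 < ε n := fun n => by positivity
  have hε1 : ∀ n, ε n ≤ 1 := fun n => by
    rw [hεdef]; simp only
    rw [div_le_one (by positivity)]
    linarith [(Nat.cast_nonneg n : (0:ℝ) ≤ n)]
  have hε0 : Filter.Tendsto ε Filter.atTop (nhds 0) := tendsto_one_div_add_atTop_nhds_zero_nat
  have hcs : ∀ {F : Type} [NormedAddCommGroup F] {g : E3 → F}, Continuous g →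
      (∀ y, R < ‖y‖ → g y = 0) → ∃ K, ∀ y, ‖g y‖ ≤ K := fun {F} _ {g} hg hz =>
    hg.bounded_above_of_compact_support <| HasCompactSupport.of_support_subset_isCompact
      (isCompact_closedBall (0:E3) R) fun y hy => by
        by_contra h
        rw [mem_closedBall_zero_iff, not_le] at h
        exact hy (hz y h)
  obtain ⟨Cf, hCf⟩ := hcs hf.continuous hfR
  obtain ⟨CD, hCD⟩ := hcs hD.continuous hDR
  have hlim := tendsto_kirch_boundary hf.continuous hD.continuous hCf hCD hε hε1 hε0
  simp only [← fun n => integral_kirch_eps (hε n) hf hD hH hHC hfR hDR hHR hd] at hlim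
  refine tendsto_nhds_unique ?_ hlim
  refine tendsto_integral_of_dominated_convergence
    (fun y => (closedBall (0:E3) R).indicator (fun y => ‖y‖⁻¹) y * C) ?_
    ((norm_inv_integrableOn R).mul_const C) ?_ ?_
  · intro n
    refine AEStronglyMeasurable.mul ?_ hH
    simpa using (contDiff_originCut_div (hε n) 1).continuous.aestronglyMeasurable
  · intro n
    refine ae_of_all _ fun y => ?_
    by_cases hy : ‖y‖ ≤ R
    · rw [indicator_of_mem (by simpa using hy), norm_mul, norm_div, norm_norm]
      have h1 : ‖originCut (‖y‖ / ε n)‖ ≤ 1 := abs_originCut_le _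
      have h2 := hHC y
      have hC0 : 0 ≤ C := (norm_nonneg _).trans h2
      rw [div_eq_mul_inv]
      have h3 : 0 ≤ ‖y‖⁻¹ := by positivity
      calc _ ≤ 1 * ‖y‖⁻¹ * C := by gcongr
        _ = _ := by ring
    · rw [hHR y (not_le.1 hy), indicator_of_notMem (by simpa using hy)]
      simp
  · refine ae_of_all _ fun y => ?_
    by_cases hy : y = 0
    · simp [hy]
    · have hr : 0 < ‖y‖ := norm_pos_iff.2 hy
      refine tendsto_const_nhds.congr' ?_
      have : ∀ᶠ n in Filter.atTop, ε n < ‖y‖ / 2 := hε0.eventually_lt_const (by positivity)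
      filter_upwards [this] with n hn
      rw [originCut_of_ge, one_div]
      rw [le_div_iff₀ (hε n)]; linarith

section radial
variable {F : Type} [NormedAddCommGroup F] [NormedSpace ℝ F]

/-- The weighted radial average `∫₀¹ σ^k b(σ x) dσ`. -/
def radInt (k : ℕ) (b : E3 → F) (x : E3) : F := ∫ σ in (0:ℝ)..1, σ ^ k • b (σ • x)

lemma continuous_radInt (k : ℕ) {b : E3 → F} (hb : Continuous b) : Continuous (radInt k b) := by
  refine intervalIntegral.continuous_parametric_intervalIntegral_of_continuous'
    (f := fun (x : E3) (σ : ℝ) => σ ^ k • b (σ • x)) ?_ 0 1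
  simp only [Function.uncurry_def]
  fun_prop

lemma hasFDerivAt_radInt (k : ℕ) {b : E3 → F} (hb : ContDiff ℝ 1 b) (x : E3) :
    HasFDerivAt (radInt k b) (radInt (k + 1) (fderiv ℝ b) x) x := by
  have hb' : Continuous (fderiv ℝ b) := hb.continuous_fderiv one_ne_zero
  obtain ⟨C, hC⟩ := (isCompact_closedBall (0:E3) (‖x‖ + 1)).exists_bound_of_continuousOn
    hb'.continuousOn
  have hC0 : 0 ≤ C := (norm_nonneg _).trans (hC 0 (mem_closedBall_self (by positivity)))
  have hm : ∀ y, Continuous fun σ : ℝ => σ ^ k • b (σ • y) := fun y => by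
    have := hb.continuous; fun_prop
  refine intervalIntegral.hasFDerivAt_integral_of_dominated_of_fderiv_le (bound := fun _ => C)
    (F' := fun y σ => σ ^ (k + 1) • fderiv ℝ b (σ • y)) (ball_mem_nhds x one_pos)
    (Filter.Eventually.of_forall fun y => (hm y).aestronglyMeasurable)
    ((hm x).intervalIntegrable 0 1) (by fun_prop) ?_ (by simp) ?_
  · refine ae_of_all _ fun σ hσ y hy => ?_
    rw [uIoc_of_le zero_le_one] at hσ
    rw [norm_smul, norm_pow, Real.norm_eq_abs, abs_of_pos hσ.1]
    have h1 : ‖fderiv ℝ b (σ • y)‖ ≤ C := by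
      refine hC _ ?_
      rw [mem_closedBall_zero_iff, norm_smul, Real.norm_eq_abs, abs_of_pos hσ.1]
      have hy' : ‖y‖ ≤ ‖x‖ + 1 := by
        rw [mem_ball, dist_eq_norm] at hy
        have := norm_sub_norm_le y x
        linarith
      exact (mul_le_of_le_one_left (norm_nonneg _) hσ.2).trans hy'
    exact (mul_le_of_le_one_left (norm_nonneg _) (pow_le_one₀ hσ.1.le hσ.2)).trans h1
  · refine ae_of_all _ fun σ _ y _ => ?_
    have h1 : HasFDerivAt (fun y : E3 => σ • y) (σ • ContinuousLinearMap.id ℝ E3) y :=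
      (hasFDerivAt_id y).const_smul σ
    have h2 : HasFDerivAt b (fderiv ℝ b (σ • y)) (σ • y) :=
      (hb.differentiable one_ne_zero _).hasFDerivAt
    refine ((h2.comp y h1).const_smul (σ ^ k)).congr_fderiv ?_
    refine ContinuousLinearMap.ext fun v => ?_
    simp [pow_succ, mul_smul]

lemma contDiff_radInt (n k : ℕ) {b : E3 → F} (hb : ContDiff ℝ n b) : ContDiff ℝ n (radInt k b) := by
  induction n generalizing k F with
  | zero => exact contDiff_zero.2 (continuous_radInt k (contDiff_zero.1 hb))
  | succ n ih =>
    push_cast at hb ⊢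
    have hd := hasFDerivAt_radInt k (hb.of_le (by simp))
    rw [contDiff_succ_iff_fderiv]
    refine ⟨fun x => (hd x).differentiableAt, by simp, ?_⟩
    rw [show fderiv ℝ (radInt k b) = radInt (k + 1) (fderiv ℝ b) from funext fun x => (hd x).fderiv]
    exact ih (k + 1) (hb.fderiv_right le_rfl)

end radial

lemma radInt_transport (k : ℕ) {b : E3 → ℝ} (hb : ContDiff ℝ 1 b) (x : E3) :
    fderiv ℝ (radInt k b) x x + (k + 1) * radInt k b x = b x := by
  have hb' : Continuous (fderiv ℝ b) := hb.continuous_fderiv one_ne_zero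
  have hbc := hb.continuous
  rw [(hasFDerivAt_radInt k hb x).fderiv]
  have h1 : radInt (k + 1) (fderiv ℝ b) x x = ∫ σ in (0:ℝ)..1, σ ^ (k + 1) * fderiv ℝ b (σ • x) x := by
    unfold radInt
    rw [ContinuousLinearMap.intervalIntegral_apply]
    · rfl
    · exact Continuous.intervalIntegrable (by fun_prop) _ _
  have hd : ∀ σ ∈ uIcc (0:ℝ) 1, HasDerivAt (fun σ : ℝ => σ ^ (k + 1) * b (σ • x))
      (σ ^ (k + 1) * fderiv ℝ b (σ • x) x + (k + 1) * (σ ^ k * b (σ • x))) σ := by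
    intro σ _
    have h2 : HasDerivAt (fun σ : ℝ => σ • x) x σ := by
      simpa using (hasDerivAt_id σ).smul_const x
    have h3 : HasDerivAt (fun σ : ℝ => b (σ • x)) (fderiv ℝ b (σ • x) x) σ :=
      ((hb.differentiable one_ne_zero _).hasFDerivAt).comp_hasDerivAt σ h2
    refine ((hasDerivAt_pow (k + 1) σ).mul h3).congr_deriv ?_
    push_cast
    ring
  have hc1 : Continuous fun σ : ℝ => σ ^ (k + 1) * fderiv ℝ b (σ • x) x := by fun_prop
  have hc2 : Continuous fun σ : ℝ => (k + 1 : ℝ) * (σ ^ k * b (σ • x)) := by fun_prop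
  have h4 := intervalIntegral.integral_eq_sub_of_hasDerivAt hd
    ((hc1.add hc2).intervalIntegrable _ _)
  rw [intervalIntegral.integral_add (hc1.intervalIntegrable _ _) (hc2.intervalIntegrable _ _),
    intervalIntegral.integral_const_mul] at h4
  rw [h1]
  simpa [radInt] using h4

/-- The Laplacian through the second derivative. -/
def lapD (a : E3 → ℝ) (x : E3) : ℝ := ∑ i, fderiv ℝ (fderiv ℝ a) x (basis3 i) (basis3 i)

lemma contDiff_lapD {n : ℕ} {a : E3 → ℝ} (ha : ContDiff ℝ (n + 2 : ℕ) a) : ContDiff ℝ n (lapD a) := by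
  have h1 : ContDiff ℝ (n + 1 : ℕ) (fderiv ℝ a) := ha.fderiv_right (by push_cast; norm_cast)
  have h2 : ContDiff ℝ n (fderiv ℝ (fderiv ℝ a)) := h1.fderiv_right (by push_cast; norm_cast)
  unfold lapD
  exact ContDiff.sum fun i _ => (h2.clm_apply contDiff_const).clm_apply contDiff_const

/-- The coefficients of the progressing wave expansion. -/
def transCoef (q : E3 → ℝ) : ℕ → E3 → ℝ
  | 0 => radInt 0 q
  | k + 1 => radInt (k + 1) fun x =>
      (lapD (transCoef q k) x + q x * transCoef q k x) / (4 * (k + 1))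

lemma contDiff_transCoef {q : E3 → ℝ} (k n : ℕ) (hq : ContDiff ℝ (n + 2 * k : ℕ) q) :
    ContDiff ℝ n (transCoef q k) := by
  induction k generalizing n with
  | zero => exact contDiff_radInt n 0 (by simpa using hq)
  | succ k ih =>
    have h1 : ContDiff ℝ (n + 2 : ℕ) (transCoef q k) := ih (n + 2) (by convert hq using 2; ring)
    have hqn : ContDiff ℝ n q := hq.of_le (by norm_cast; omega)
    refine contDiff_radInt n (k + 1) ?_
    exact ((contDiff_lapD h1).add (hqn.mul (h1.of_le (by norm_cast; omega)))).div_const _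

lemma transCoef_succ_transport {q : E3 → ℝ} (k : ℕ) (hq : ContDiff ℝ (1 + 2 * (k + 1) : ℕ) q) (x : E3) :
    4 * (k + 1) * (fderiv ℝ (transCoef q (k + 1)) x x + (k + 2) * transCoef q (k + 1) x) =
      lapD (transCoef q k) x + q x * transCoef q k x := by
  have h1 : ContDiff ℝ (1 + 2 : ℕ) (transCoef q k) :=
    contDiff_transCoef k (1 + 2) (by convert hq using 2; ring)
  have hq1 : ContDiff ℝ (1 : ℕ) q := hq.of_le (by norm_cast; omega)
  have hb : ContDiff ℝ (1 : ℕ) fun x =>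
      (lapD (transCoef q k) x + q x * transCoef q k x) / (4 * (k + 1)) :=
    ((contDiff_lapD h1).add (hq1.mul (h1.of_le (by norm_cast)))).div_const _
  have h := radInt_transport (k + 1) (hb.of_le (by simp)) x
  have hk : (4 * ((k:ℝ) + 1)) ≠ 0 := by positivity
  rw [transCoef, show ((k:ℝ) + 2) = ((k + 1 : ℕ) : ℝ) + 1 by push_cast; ring, h]
  field_simp

/-- The wave operator `∂_t² - Δ`. -/
def box (f : Spt → ℝ) (p : Spt) : ℝ := boxL (fderiv ℝ (fderiv ℝ f) p)

section
variable {E : Type} [NormedAddCommGroup E] [NormedSpace ℝ E]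

lemma ContDiffAt.differentiableAt_fderiv {f : E → ℝ} {p : E} (hf : ContDiffAt ℝ 2 f p) :
    DifferentiableAt ℝ (fderiv ℝ f) p :=
  (hf.fderiv_right (m := 1) (by norm_num)).differentiableAt one_ne_zero

lemma ContDiffAt.eventually_differentiableAt {f : E → ℝ} {p : E} (hf : ContDiffAt ℝ 2 f p) :
    ∀ᶠ q in nhds p, DifferentiableAt ℝ f q := by
  filter_upwards [hf.eventually (by simp)] with q hq using hq.differentiableAt two_ne_zero

lemma fderiv_fderiv_eq {f : E → ℝ} {p : E} (hf : ContDiffAt ℝ 2 f p) (v w : E) :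
    fderiv ℝ (fderiv ℝ f) p v w = fderiv ℝ (fun q => fderiv ℝ f q w) p v := by
  have h := hf.differentiableAt_fderiv.hasFDerivAt.clm_apply (hasFDerivAt_const w p)
  rw [h.fderiv]
  simp

lemma fderiv_fderiv_mul {f g : E → ℝ} {p : E} (hf : ContDiffAt ℝ 2 f p) (hg : ContDiffAt ℝ 2 g p)
    (v w : E) : fderiv ℝ (fderiv ℝ fun q => f q * g q) p v w =
      f p * fderiv ℝ (fderiv ℝ g) p v w + g p * fderiv ℝ (fderiv ℝ f) p v w
        + fderiv ℝ f p v * fderiv ℝ g p w + fderiv ℝ g p v * fderiv ℝ f p w := by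
  rw [fderiv_fderiv_eq (hf.mul hg)]
  have he : (fun q => fderiv ℝ (fun q => f q * g q) q w) =ᶠ[nhds p]
      fun q => f q * fderiv ℝ g q w + g q * fderiv ℝ f q w := by
    filter_upwards [hf.eventually_differentiableAt, hg.eventually_differentiableAt] with q h1 h2
    rw [fderiv_fun_mul h1 h2]; simp
  rw [he.fderiv_eq]
  have h1 := (hf.differentiableAt two_ne_zero).hasFDerivAt
  have h2 := (hg.differentiableAt two_ne_zero).hasFDerivAt
  have h3 := hf.differentiableAt_fderiv.hasFDerivAt.clm_apply (hasFDerivAt_const w p)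
  have h4 := hg.differentiableAt_fderiv.hasFDerivAt.clm_apply (hasFDerivAt_const w p)
  refine (DFunLike.congr_fun ((h1.mul h4).add (h2.mul h3)).fderiv v).trans ?_
  simp
  ring

lemma fderiv_fderiv_comp {χ : ℝ → ℝ} {g : E → ℝ} {p : E} (hχ : ContDiff ℝ 2 χ)
    (hg : ContDiffAt ℝ 2 g p) (v w : E) : fderiv ℝ (fderiv ℝ fun q => χ (g q)) p v w =
      deriv (deriv χ) (g p) * fderiv ℝ g p v * fderiv ℝ g p w
        + deriv χ (g p) * fderiv ℝ (fderiv ℝ g) p v w := by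
  have hχg : ContDiffAt ℝ 2 (fun q => χ (g q)) p := hχ.contDiffAt.comp p hg
  rw [fderiv_fderiv_eq hχg]
  have hχd : ∀ s, HasDerivAt χ (deriv χ s) s := fun s =>
    (hχ.differentiable two_ne_zero s).hasDerivAt
  have hχ' : ContDiff ℝ 1 (deriv χ) := by
    have : ContDiff ℝ (1 + 1) χ := by norm_num; exact hχ
    exact (contDiff_succ_iff_deriv.1 this).2.2
  have hχd' : HasDerivAt (deriv χ) (deriv (deriv χ) (g p)) (g p) :=
    (hχ'.differentiable one_ne_zero _).hasDerivAt
  have he : (fun q => fderiv ℝ (fun q => χ (g q)) q w) =ᶠ[nhds p]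
      fun q => deriv χ (g q) * fderiv ℝ g q w := by
    filter_upwards [hg.eventually_differentiableAt] with q h1
    exact (DFunLike.congr_fun ((hχd (g q)).comp_hasFDerivAt q h1.hasFDerivAt).fderiv w).trans
      (by simp)
  rw [he.fderiv_eq]
  have h1 := (hg.differentiableAt two_ne_zero).hasFDerivAt
  have h2 := hg.differentiableAt_fderiv.hasFDerivAt.clm_apply (hasFDerivAt_const w p)
  have h3 := hχd'.comp_hasFDerivAt p h1
  refine (DFunLike.congr_fun (h3.mul h2).fderiv v).trans ?_
  simp
  ring

end

lemma hasFDerivAt_lor (p : Spt) :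
    HasFDerivAt lor ((2 * p.2) • ContinuousLinearMap.snd ℝ E3 ℝ
      - (2:ℝ) • (innerSL ℝ p.1).comp (ContinuousLinearMap.fst ℝ E3 ℝ)) p := by
  have h1 : HasFDerivAt (fun q : Spt => q.2) (ContinuousLinearMap.snd ℝ E3 ℝ) p := hasFDerivAt_snd
  have h2 : HasFDerivAt (fun q : Spt => q.1) (ContinuousLinearMap.fst ℝ E3 ℝ) p := hasFDerivAt_fst
  refine ((h1.pow 2).sub h2.norm_sq).congr_fderiv ?_
  refine ContinuousLinearMap.ext fun v => ?_
  simp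

lemma fderiv_lor (p v : Spt) : fderiv ℝ lor p v = 2 * p.2 * v.2 - 2 * inner ℝ p.1 v.1 := by
  rw [(hasFDerivAt_lor p).fderiv]; simp

lemma fderiv_fderiv_lor (p v w : Spt) :
    fderiv ℝ (fderiv ℝ lor) p v w = 2 * v.2 * w.2 - 2 * inner ℝ v.1 w.1 := by
  rw [fderiv_fderiv_eq contDiff_lor.contDiffAt]
  simp only [fderiv_lor]
  have h1 : HasFDerivAt (fun q : Spt => q.2) (ContinuousLinearMap.snd ℝ E3 ℝ) p := hasFDerivAt_snd
  have h2 : HasFDerivAt (fun q : Spt => q.1) (ContinuousLinearMap.fst ℝ E3 ℝ) p := hasFDerivAt_fst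
  have h3 := ((h1.const_mul 2).mul_const w.2).sub
    ((h2.inner ℝ (hasFDerivAt_const w.1 p)).const_mul 2)
  refine (DFunLike.congr_fun h3.fderiv v).trans ?_
  simp
  ring

lemma inner_basis3 (x : E3) (i : Fin 3) : inner ℝ x (basis3 i) = x i := by
  rw [basis3, EuclideanSpace.inner_single_right]; simp

lemma norm_basis3 (i : Fin 3) : ‖basis3 i‖ = 1 := by simp [basis3]

lemma sum_smul_basis3 (x : E3) : x = x 0 • basis3 0 + x 1 • basis3 1 + x 2 • basis3 2 := by
  ext j; fin_cases j <;> simp [basis3]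

lemma spt_eq (p : Spt) : p = p.2 • ((0, 1) : Spt) + p.1 0 • (basis3 0, 0) + p.1 1 • (basis3 1, 0)
    + p.1 2 • (basis3 2, 0) := by
  refine Prod.ext ?_ (by simp)
  simpa using sum_smul_basis3 p.1

/-- The commutator of the wave operator with a function of the Lorentz form. -/
lemma box_comp_lor_mul {χ : ℝ → ℝ} {f : Spt → ℝ} {p : Spt} (hχ : ContDiff ℝ 2 χ)
    (hf : ContDiffAt ℝ 2 f p) :
    box (fun q => χ (lor q) * f q) p = χ (lor p) * box f p
      + (4 * lor p * deriv (deriv χ) (lor p) + 8 * deriv χ (lor p)) * f p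
      + 4 * deriv χ (lor p) * fderiv ℝ f p p := by
  have hlor : ContDiffAt ℝ 2 lor p := contDiff_lor.contDiffAt
  have hc : ContDiffAt ℝ 2 (fun q => χ (lor q)) p := hχ.contDiffAt.comp p hlor
  have hd : ∀ v, fderiv ℝ (fun q => χ (lor q)) p v = deriv χ (lor p) * fderiv ℝ lor p v := by
    intro v
    have := ((hχ.differentiable two_ne_zero (lor p)).hasDerivAt).comp_hasFDerivAt p
      (hasFDerivAt_lor p).differentiableAt.hasFDerivAt
    exact (DFunLike.congr_fun this.fderiv v).trans (by simp)
  have hp : fderiv ℝ f p p = p.2 * fderiv ℝ f p (0, 1) + p.1 0 * fderiv ℝ f p (basis3 0, 0)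
      + p.1 1 * fderiv ℝ f p (basis3 1, 0) + p.1 2 * fderiv ℝ f p (basis3 2, 0) := by
    conv_lhs => rw [spt_eq p, map_add, map_add, map_add, map_smul, map_smul, map_smul, map_smul]
    simp only [smul_eq_mul, ← spt_eq p]
  have hr : ‖p.1‖ ^ 2 = p.1 0 ^ 2 + p.1 1 ^ 2 + p.1 2 ^ 2 := by
    rw [EuclideanSpace.norm_sq_eq, Fin.sum_univ_three]; simp
  unfold box boxL
  simp only [fderiv_fderiv_mul hc hf, fderiv_fderiv_comp hχ hlor, hd, fderiv_lor, fderiv_fderiv_lor,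
    Fin.sum_univ_three, inner_basis3, inner_zero_right, real_inner_self_eq_norm_sq, norm_basis3, hp]
  generalize fderiv ℝ f p = L
  generalize fderiv ℝ (fderiv ℝ f) p = B
  rw [show lor p = p.2 ^ 2 - ‖p.1‖ ^ 2 from rfl]
  generalize hs : p.2 ^ 2 - ‖p.1‖ ^ 2 = s
  have hs' : s = p.2 ^ 2 - (p.1 0 ^ 2 + p.1 1 ^ 2 + p.1 2 ^ 2) := by rw [← hs, hr]
  linear_combination (-4 * deriv (deriv χ) s * f p) * hs'

lemma fderiv_comp_fst {a : E3 → ℝ} {p : Spt} (ha : DifferentiableAt ℝ a p.1) (v : Spt) :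
    fderiv ℝ (fun q : Spt => a q.1) p v = fderiv ℝ a p.1 v.1 := by
  have h2 : HasFDerivAt (fun q : Spt => q.1) (ContinuousLinearMap.fst ℝ E3 ℝ) p := hasFDerivAt_fst
  exact (DFunLike.congr_fun (ha.hasFDerivAt.comp p h2).fderiv v).trans (by simp)

lemma box_comp_fst {a : E3 → ℝ} (ha : ContDiff ℝ 2 a) (p : Spt) :
    box (fun q : Spt => a q.1) p = - lapD a p.1 := by
  have h : ∀ v w, fderiv ℝ (fderiv ℝ fun q : Spt => a q.1) p v w
      = fderiv ℝ (fderiv ℝ a) p.1 v.1 w.1 := by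
    intro v w
    have hc : ContDiffAt ℝ 2 (fun q : Spt => a q.1) p := (ha.comp contDiff_fst).contDiffAt
    rw [fderiv_fderiv_eq hc]
    simp only [fun q : Spt => fderiv_comp_fst (p := q) (ha.differentiable two_ne_zero q.1)]
    have hd : DifferentiableAt ℝ (fun x => fderiv ℝ a x w.1) p.1 :=
      (ha.contDiffAt.differentiableAt_fderiv).clm_apply (differentiableAt_const _)
    rw [fderiv_comp_fst (a := fun x => fderiv ℝ a x w.1) hd, fderiv_fderiv_eq ha.contDiffAt]
  unfold box boxL lapD
  simp only [h]
  simp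

lemma box_add {f g : Spt → ℝ} {p : Spt} (hf : ContDiffAt ℝ 2 f p) (hg : ContDiffAt ℝ 2 g p) :
    box (fun q => f q + g q) p = box f p + box g p := by
  have he : fderiv ℝ (fun q => f q + g q) =ᶠ[nhds p] fun q => fderiv ℝ f q + fderiv ℝ g q := by
    filter_upwards [hf.eventually_differentiableAt, hg.eventually_differentiableAt] with q h1 h2
    exact fderiv_fun_add h1 h2
  unfold box
  rw [he.fderiv_eq, fderiv_fun_add hf.differentiableAt_fderiv hg.differentiableAt_fderiv]
  simp only [boxL, add_apply, Finset.sum_add_distrib]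
  ring

/-- The progressing wave expansion truncated at order `N`. -/
def waveSum (q : E3 → ℝ) (N : ℕ) (p : Spt) : ℝ :=
  ∑ k ∈ Finset.range (N + 1), lor p ^ k * transCoef q k p.1

lemma contDiff_waveSum {q : E3 → ℝ} (N n : ℕ) (hq : ContDiff ℝ (n + 2 * N : ℕ) q) :
    ContDiff ℝ n (waveSum q N) := by
  refine ContDiff.sum fun k hk => (contDiff_lor.pow k).mul ?_
  have hk' : k < N + 1 := Finset.mem_range.1 hk
  exact (contDiff_transCoef k n (hq.of_le (by norm_cast; omega))).comp contDiff_fst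

lemma box_waveSum {q : E3 → ℝ} (N : ℕ) (hq : ContDiff ℝ (2 + 2 * N : ℕ) q) (p : Spt) :
    box (waveSum q N) p - q p.1 * waveSum q N p =
      - (lor p ^ N * (lapD (transCoef q N) p.1 + q p.1 * transCoef q N p.1)) := by
  induction N with
  | zero =>
    have ha : ContDiff ℝ 2 (transCoef q 0) := contDiff_transCoef 0 2 hq
    have : waveSum q 0 = fun p : Spt => transCoef q 0 p.1 := by funext p; simp [waveSum]
    rw [this, box_comp_fst ha]
    ring
  | succ N ih =>
    have ha : ContDiff ℝ 2 (transCoef q (N + 1)) := contDiff_transCoef (N + 1) 2 hq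
    have hq' : ContDiff ℝ (2 + 2 * N : ℕ) q := hq.of_le (by norm_cast; omega)
    have hsum : waveSum q (N + 1) = fun p => waveSum q N p
        + lor p ^ (N + 1) * transCoef q (N + 1) p.1 := by
      funext p; rw [waveSum, Finset.sum_range_succ]; rfl
    have haf : ContDiff ℝ 2 fun p : Spt => transCoef q (N + 1) p.1 := ha.comp contDiff_fst
    have h1 := ih hq'
    have h2 := transCoef_succ_transport N (q := q) (hq.of_le (by norm_cast; omega)) p.1
    have h3 := box_comp_lor_mul (χ := fun s => s ^ (N + 1)) (p := p) (by fun_prop) haf.contDiffAt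
    have hd1 : deriv (fun s : ℝ => s ^ (N + 1)) = fun s => (N + 1 : ℝ) * s ^ N := by
      funext s; simp
    have hd2 : lor p * deriv (fun s : ℝ => (N + 1 : ℝ) * s ^ N) (lor p)
        = (N + 1 : ℝ) * N * lor p ^ N := by
      rw [deriv_const_mul_field]
      rcases N with _ | N
      · simp
      · simp; ring
    rw [hd1, box_comp_fst ha, fderiv_comp_fst (ha.differentiable two_ne_zero _)] at h3
    rw [hsum, box_add (contDiff_waveSum N 2 hq').contDiffAt
      ((contDiff_lor.pow (N + 1)).mul haf).contDiffAt, h3]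
    linear_combination h1 + lor p ^ N * h2 + 4 * transCoef q (N + 1) p.1 * hd2

/-- The exponentially damped kernel of the retarded potential. -/
def expKer (Λ : ℝ) (y : E3) : ℝ := exp (-Λ * ‖y‖) * (kirchConst⁻¹ * ‖y‖⁻¹)

lemma measurable_expKer (Λ : ℝ) : Measurable (expKer Λ) := by
  unfold expKer; fun_prop

lemma expKer_nonneg (Λ : ℝ) (y : E3) : 0 ≤ expKer Λ y := by
  have := kirchConst_pos
  unfold expKer; positivity

lemma expKer_le {Λ : ℝ} (hΛ : 1 ≤ Λ) (y : E3) : expKer Λ y ≤ expKer 1 y := by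
  have := kirchConst_pos
  unfold expKer
  gcongr

lemma integrable_expKer {Λ : ℝ} (hΛ : 1 ≤ Λ) : Integrable (expKer Λ) := by
  have hc := kirchConst_pos
  have h1 : Integrable fun y : E3 => (1 + ‖y‖) ^ (-(4:ℝ)) :=
    integrable_one_add_norm (by simp; norm_num)
  have h2 := (norm_inv_integrableOn 1).add (h1.const_mul (24 * exp 1))
  refine (h2.const_mul kirchConst⁻¹).mono' (measurable_expKer Λ).aestronglyMeasurable
    (ae_of_all _ fun y => ?_)
  rw [Real.norm_of_nonneg (expKer_nonneg Λ y)]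
  refine (expKer_le hΛ y).trans ?_
  have hr := norm_nonneg y
  have hpos : 0 ≤ 24 * exp 1 * (1 + ‖y‖) ^ (-(4:ℝ)) := by positivity
  have hexp1 : exp (-1 * ‖y‖) ≤ 1 := exp_le_one_iff.2 (by linarith)
  unfold expKer
  simp only [Pi.add_apply]
  rw [mul_left_comm]
  refine mul_le_mul_of_nonneg_left ?_ (inv_nonneg.2 hc.le)
  by_cases hy : y ∈ closedBall (0:E3) 1
  · rw [indicator_of_mem hy]
    nlinarith [inv_nonneg.2 hr]
  · rw [indicator_of_notMem hy, zero_add]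
    rw [mem_closedBall_zero_iff, not_le] at hy
    have h3 := Real.pow_div_factorial_le_exp (1 + ‖y‖) (by positivity) 4
    have h4 : (1 + ‖y‖) ^ (-(4:ℝ)) = ((1 + ‖y‖) ^ 4)⁻¹ := by
      rw [rpow_neg (by positivity)]; norm_cast
    rw [h4]
    have h5 : exp (-1 * ‖y‖) = exp 1 * (exp (1 + ‖y‖))⁻¹ := by
      rw [← exp_neg, ← exp_add]; congr 1; ring
    have h6 : (exp (1 + ‖y‖))⁻¹ ≤ 24 * ((1 + ‖y‖) ^ 4)⁻¹ := by
      have h7 : (1 + ‖y‖) ^ 4 * 24⁻¹ ≤ exp (1 + ‖y‖) := by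
        simpa [Nat.factorial, div_eq_mul_inv] using h3
      have := inv_anti₀ (by positivity) h7
      rwa [mul_inv, inv_inv, mul_comm] at this
    have h8 : ‖y‖⁻¹ ≤ 1 := inv_le_one_of_one_le₀ hy.le
    calc exp (-1 * ‖y‖) * ‖y‖⁻¹ ≤ exp (-1 * ‖y‖) * 1 := by gcongr
      _ = exp 1 * (exp (1 + ‖y‖))⁻¹ := by rw [mul_one, h5]
      _ ≤ exp 1 * (24 * ((1 + ‖y‖) ^ 4)⁻¹) := by gcongr
      _ = _ := by ring

lemma exists_integral_expKer_le {δ : ℝ} (hδ : 0 < δ) : ∃ Λ, 1 ≤ Λ ∧ ∫ y, ‖expKer Λ y‖ ≤ δ := by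
  have h : Filter.Tendsto (fun n : ℕ => ∫ y, ‖expKer (n + 1) y‖) Filter.atTop
      (nhds (∫ _ : E3, (0:ℝ))) := by
    refine tendsto_integral_of_dominated_convergence (expKer 1)
      (fun n => (measurable_expKer _).norm.aestronglyMeasurable) (integrable_expKer le_rfl)
      (fun n => ae_of_all _ fun y => ?_) (ae_of_all _ fun y => ?_)
    · rw [norm_norm, Real.norm_of_nonneg (expKer_nonneg _ y)]
      exact expKer_le (by simp) y
    · by_cases hy : y = 0
      · simp [hy, expKer]
      · have hr : 0 < ‖y‖ := norm_pos_iff.2 hy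
        have h1 : Filter.Tendsto (fun n : ℕ => ((n:ℝ) + 1) * ‖y‖) Filter.atTop Filter.atTop :=
          (Filter.tendsto_atTop_add_const_right _ _ tendsto_natCast_atTop_atTop).atTop_mul_const hr
        have h2 := (Real.tendsto_exp_neg_atTop_nhds_zero.comp h1).mul_const (kirchConst⁻¹ * ‖y‖⁻¹)
        rw [zero_mul] at h2
        simpa only [expKer, norm_zero, Function.comp_def, neg_mul] using h2.norm
  rw [integral_zero] at h
  obtain ⟨n, hn⟩ := (h.eventually (gt_mem_nhds hδ)).exists
  exact ⟨n + 1, by simp, hn.le⟩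

lemma retConv_eq_zero {F : Type} [NormedAddCommGroup F] [NormedSpace ℝ F] {k : E3 → ℝ}
    {f : Spt → F} (hf : ∀ p : Spt, p.2 ≤ ‖p.1‖ → f p = 0) {p : Spt} (hp : p.2 ≤ ‖p.1‖) :
    retConv k f p = 0 := by
  unfold retConv
  refine (integral_congr_ae (ae_of_all _ fun y => ?_)).trans (integral_zero _ _)
  have : f (p - (y, ‖y‖)) = 0 := hf _ (by
    have := norm_sub_norm_le p.1 y
    simp only [Prod.snd_sub, Prod.fst_sub]
    linarith)
  simp [this]

/-- Neumann series solution of the damped integral equation. -/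
lemma exists_fixedPoint_retConv {m : ℕ} {k : E3 → ℝ} (hk : Integrable k) {Q g : Spt → ℝ}
    {A B : ℝ} (hQ : BddC m Q A) (hθ : (∫ y, ‖k y‖) * (2 ^ m * A) ≤ 1 / 2)
    (hg : BddC m (retConv k g) B) (hgm : StronglyMeasurable g) {C : ℝ} (hgC : ∀ p, ‖g p‖ ≤ C)
    (hg0 : ∀ p : Spt, p.2 ≤ ‖p.1‖ → g p = 0) :
    ∃ w : Spt → ℝ, ContDiff ℝ m w ∧ (∀ p : Spt, p.2 ≤ ‖p.1‖ → w p = 0) ∧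
      w = retConv k (fun p => Q p * w p + g p) := by
  let f : ℕ → Spt → ℝ := fun n => Nat.rec (retConv k g) (fun _ h => retConv k fun p => Q p * h p) n
  have hf0 : f 0 = retConv k g := rfl
  have hfs : ∀ n, f (n + 1) = retConv k fun p => Q p * f n p := fun n => rfl
  have hB := hg.nonneg
  have hbd : ∀ n, BddC m (f n) (B * (1 / 2) ^ n) := by
    intro n
    induction n with
    | zero => simpa [hf0] using hg
    | succ n ih =>
      rw [hfs]
      refine ((hQ.mul ih).retConv hk).mono ?_
      calc (∫ y, ‖k y‖) * (2 ^ m * A * (B * (1 / 2) ^ n))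
          = ((∫ y, ‖k y‖) * (2 ^ m * A)) * (B * (1 / 2) ^ n) := by ring
        _ ≤ 1 / 2 * (B * (1 / 2) ^ n) := by gcongr
        _ = _ := by ring
  have hsum : Summable fun n : ℕ => B * (1 / 2 : ℝ) ^ n := summable_geometric_two.mul_left B
  have hz : ∀ n, ∀ p : Spt, p.2 ≤ ‖p.1‖ → f n p = 0 := by
    intro n
    induction n with
    | zero => exact fun p hp => retConv_eq_zero hg0 hp
    | succ n ih =>
      intro p hp
      rw [hfs]
      exact retConv_eq_zero (fun q hq => by rw [ih q hq, mul_zero]) hp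
  obtain ⟨hw, hwb⟩ := BddC.tsum hbd hsum
  have hs : ∀ p, Summable fun n => f n p := fun p =>
    Summable.of_norm_bounded hsum fun n => (hbd n).norm_le p
  refine ⟨fun p => ∑' n, f n p, hw, fun p hp => by simp [hz _ p hp], ?_⟩
  funext p
  have hQw := hQ.mul hwb
  have h1 : retConv k (fun p => Q p * (∑' n, f n p) + g p) p
      = retConv k (fun p => Q p * ∑' n, f n p) p + retConv k g p := by
    unfold retConv
    rw [← integral_add (integrable_retConv hk hQw.1.continuous.stronglyMeasurable hQw.norm_le p)
      (integrable_retConv hk hgm hgC p)]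
    simp only [smul_add]
  have h2 : HasSum (fun n => f (n + 1) p) (retConv k (fun p => Q p * ∑' n, f n p) p) := by
    have hbn := fun n => hQ.mul (hbd n)
    have h3 := hasSum_integral_of_summable_integral_norm
      (F := fun n y => k y • (Q (p - (y, ‖y‖)) * f n (p - (y, ‖y‖)))) (μ := volume)
      (fun n => integrable_retConv (f := fun p => Q p * f n p) hk
        (hbn n).1.continuous.stronglyMeasurable (hbn n).norm_le p) ?_
    · have h4 : retConv k (fun p => Q p * ∑' n, f n p) p
          = ∫ y, ∑' n, k y • (Q (p - (y, ‖y‖)) * f n (p - (y, ‖y‖))) := by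
        unfold retConv
        refine integral_congr_ae (ae_of_all _ fun y => ?_)
        simp only [smul_eq_mul]
        rw [tsum_mul_left, tsum_mul_left]
      rw [h4]
      exact h3
    · refine Summable.of_nonneg_of_le (fun n => by positivity) (fun n => ?_)
        (hsum.mul_left ((∫ y, ‖k y‖) * (2 ^ m * A)))
      calc ∫ y, ‖k y • (Q (p - (y, ‖y‖)) * f n (p - (y, ‖y‖)))‖
          ≤ ∫ y, ‖k y‖ * (2 ^ m * A * (B * (1 / 2) ^ n)) := by
            refine integral_mono_of_nonneg (ae_of_all _ fun y => norm_nonneg _)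
              (hk.norm.mul_const _) (ae_of_all _ fun y => ?_)
            simp only [norm_smul]
            gcongr
            exact (hbn n).norm_le _
        _ = _ := by rw [integral_mul_const]; ring
  rw [h1, ← h2.tsum_eq, ← hf0, add_comm]
  exact (hs p).tsum_eq_zero_add

/-- Solution of the retarded integral equation with a cone-supported source. -/
lemma exists_retarded_solution {m : ℕ} {Q b : Spt → ℝ} (hQ : ContDiff ℝ m Q)
    (hQc : HasCompactSupport Q) (hb : ContDiff ℝ m b) (hbc : HasCompactSupport b) :
    ∃ w : Spt → ℝ, ContDiff ℝ m w ∧ (∀ p : Spt, p.2 ≤ ‖p.1‖ → w p = 0) ∧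
      ∀ p, w p = ∫ y, kirchConst⁻¹ * ‖y‖⁻¹ *
        (Q (pastCone p y) * w (pastCone p y) + conePow m b (pastCone p y)) := by
  obtain ⟨A, hA⟩ := exists_bddC_of_hasCompactSupport hQ hQc
  have hA0 := hA.nonneg
  obtain ⟨Λ, hΛ, hδ⟩ := exists_integral_expKer_le (δ := (2 * (2 ^ m * A + 1))⁻¹) (by positivity)
  have hexp : ∀ c : ℝ, ContDiff ℝ m fun p : Spt => exp (c * p.2) := fun c => by fun_prop
  set b' : Spt → ℝ := fun p => exp (-Λ * p.2) * b p with hb'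
  have hbs : ContDiff ℝ m b' := (hexp _).mul hb
  have hbc' : HasCompactSupport b' := hbc.mul_left
  obtain ⟨B, hB⟩ := exists_bddC_retConv_conePow (integrable_expKer hΛ) m hbs hbc'
  obtain ⟨C, hC⟩ := exists_norm_conePow_le m hbs.continuous hbc'
  have hθ : (∫ y, ‖expKer Λ y‖) * (2 ^ m * A) ≤ 1 / 2 := by
    calc (∫ y, ‖expKer Λ y‖) * (2 ^ m * A) ≤ (2 * (2 ^ m * A + 1))⁻¹ * (2 ^ m * A) := by gcongr
      _ ≤ (2 * (2 ^ m * A + 1))⁻¹ * (2 ^ m * A + 1) := by gcongr; linarith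
      _ = 1 / 2 := by
        have : (2 ^ m * A + 1) ≠ 0 := by positivity
        field_simp
  obtain ⟨w, hw, hw0, hwe⟩ := exists_fixedPoint_retConv (integrable_expKer hΛ) hA hθ hB
    (stronglyMeasurable_conePow m hbs.continuous) hC fun p hp => conePow_of_le hp
  refine ⟨fun p => exp (Λ * p.2) * w p, (hexp _).mul hw, fun p hp => by simp [hw0 p hp],
    fun p => ?_⟩
  have hwp := congrFun hwe p
  beta_reduce
  rw [hwp, retConv, ← integral_const_mul]
  refine integral_congr_ae (ae_of_all _ fun y => ?_)
  have hP : p - (y, ‖y‖) = pastCone p y := rfl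
  have ht : (pastCone p y).2 = p.2 - ‖y‖ := rfl
  have hg : conePow m b (pastCone p y) = exp (Λ * (pastCone p y).2) *
      conePow m b' (pastCone p y) := by
    rcases le_or_gt (pastCone p y).2 ‖(pastCone p y).1‖ with h | h
    · rw [conePow_of_le h, conePow_of_le h, mul_zero]
    · rw [conePow_of_lt h, conePow_of_lt h, hb']
      simp only [smul_eq_mul, neg_mul]
      rw [exp_neg]
      field_simp
  have he : exp (Λ * p.2) * exp (-Λ * ‖y‖) = exp (Λ * (pastCone p y).2) := by
    rw [ht, ← exp_add]; congr 1; ring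
  simp only [hP, hg, smul_eq_mul, expKer]
  rw [← he]
  ring

/-- The truncated kernel of the retarded potential. -/
def cutKer (T : ℝ) (y : E3) : ℝ := kirchConst⁻¹ * (closedBall (0:E3) T).indicator (fun y => ‖y‖⁻¹) y

lemma integrable_cutKer (T : ℝ) : Integrable (cutKer T) := (norm_inv_integrableOn T).const_mul _

/-- `boxL` as a continuous linear map. -/
def boxCLM : (Spt →L[ℝ] Spt →L[ℝ] ℝ) →L[ℝ] ℝ :=
  LinearMap.mkContinuous
    { toFun := boxL
      map_add' := fun A B => by simp only [boxL, add_apply, Finset.sum_add_distrib]; ring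
      map_smul' := fun c A => by
        simp only [boxL, smul_apply, smul_eq_mul, ← Finset.mul_sum, RingHom.id_apply]
        ring } 4 norm_boxL_le

lemma boxCLM_apply (B : Spt →L[ℝ] Spt →L[ℝ] ℝ) : boxCLM B = boxL B := rfl

lemma eq_retConv_cutKer {F : Type} [NormedAddCommGroup F] [NormedSpace ℝ F] {f : Spt → F}
    (hf : ∀ p : Spt, p.2 < ‖p.1‖ → f p = 0) {T : ℝ} {p : Spt} (hp : p.2 < T) :
    ∫ y, (kirchConst⁻¹ * ‖y‖⁻¹) • f (pastCone p y) = retConv (cutKer T) f p := by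
  refine integral_congr_ae (ae_of_all _ fun y => ?_)
  by_cases hy : y ∈ closedBall (0:E3) T
  · simp only [cutKer, indicator_of_mem hy]; rfl
  · rw [mem_closedBall_zero_iff, not_le] at hy
    have h0 : f (pastCone p y) = 0 := hf _ (by
      have : (pastCone p y).2 = p.2 - ‖y‖ := rfl
      have := norm_nonneg (pastCone p y).1
      linarith)
    have h0' : f (p - (y, ‖y‖)) = 0 := h0
    simp [h0, h0']

lemma box_of_retarded {j : ℕ} {Q w b : Spt → ℝ} (hQ : ContDiff ℝ 2 Q) (hQc : HasCompactSupport Q)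
    (hb : ContDiff ℝ 2 b) (hbc : HasCompactSupport b) (hw : ContDiff ℝ 2 w)
    (hw0 : ∀ p : Spt, p.2 ≤ ‖p.1‖ → w p = 0)
    (hV : ∀ p, w p = ∫ y, kirchConst⁻¹ * ‖y‖⁻¹ *
      (Q (pastCone p y) * w (pastCone p y) + conePow (j + 2) b (pastCone p y))) (p : Spt) :
    box w p = Q p * w p + conePow (j + 2) b p := by
  set W : Spt → ℝ := fun p => Q p * w p with hW
  have hWs : ContDiff ℝ 2 W := hQ.mul hw
  have hWc : HasCompactSupport W := hQc.mul_right
  have hb1 : ContDiff ℝ 1 (conePowDeriv (j + 1) b) := contDiff_conePowDeriv (m := 1) _ hb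
  have hb1c := hasCompactSupport_conePowDeriv (j + 1) hbc
  have hb2 : ContDiff ℝ 0 (conePowDeriv j (conePowDeriv (j + 1) b)) :=
    contDiff_conePowDeriv (m := 0) _ (by simpa using hb1)
  have hb2c := hasCompactSupport_conePowDeriv j hb1c
  obtain ⟨A, hA⟩ := exists_bddC_of_hasCompactSupport (m := 2) hWs hWc
  have hA' := (bddC_succ.1 hA).2.2
  have hA'' := (bddC_succ.1 hA').2.2
  have hLW := hA.lipschitzWith
  have hLW' := hA'.lipschitzWith
  obtain ⟨K, hK⟩ := exists_lipschitzWith_conePow (j + 1) (hb.of_le (by norm_num)) hbc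
  obtain ⟨K', hK'⟩ := exists_lipschitzWith_conePow j hb1 hb1c
  obtain ⟨C, hC⟩ := exists_norm_conePow_le (j + 2) hb.continuous hbc
  obtain ⟨C', hC'⟩ := exists_norm_conePow_le (j + 1) hb1.continuous hb1c
  obtain ⟨C'', hC''⟩ := exists_norm_conePow_le j hb2.continuous hb2c
  set f : Spt → ℝ := fun p => W p + conePow (j + 2) b p with hf
  set f' : Spt → Spt →L[ℝ] ℝ := fun p => fderiv ℝ W p + conePow (j + 1) (conePowDeriv (j + 1) b) p
    with hf'
  set f'' : Spt → Spt →L[ℝ] Spt →L[ℝ] ℝ := fun p => fderiv ℝ (fderiv ℝ W) p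
    + conePow j (conePowDeriv j (conePowDeriv (j + 1) b)) p with hf''
  have hfL : LipschitzWith (A.toNNReal + K) f := hLW.add hK
  have hfL' : LipschitzWith (A.toNNReal + K') f' := hLW'.add hK'
  have hfC : ∀ p, ‖f p‖ ≤ A + C := fun p =>
    (norm_add_le _ _).trans (add_le_add (hA.norm_le p) (hC p))
  have hfC' : ∀ p, ‖f' p‖ ≤ A + C' := fun p =>
    (norm_add_le _ _).trans (add_le_add (hA'.norm_le p) (hC' p))
  have hfC'' : ∀ p, ‖f'' p‖ ≤ A + C'' := fun p =>
    (norm_add_le _ _).trans (add_le_add (hA''.norm_le p) (hC'' p))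
  have hm'' : StronglyMeasurable f'' := hA''.1.continuous.stronglyMeasurable.add
    (stronglyMeasurable_conePow j hb2.continuous)
  have hd : ∀ p : Spt, ‖p.1‖ ≠ p.2 → HasFDerivAt f (f' p) p := fun p hp =>
    (hWs.differentiable two_ne_zero p).hasFDerivAt.add
      (hasFDerivAt_conePow (hb.differentiable two_ne_zero) hp)
  have hd' : ∀ p : Spt, ‖p.1‖ ≠ p.2 → HasFDerivAt f' (f'' p) p := fun p hp =>
    (hWs.contDiffAt.differentiableAt_fderiv).hasFDerivAt.add
      (hasFDerivAt_conePow (hb1.differentiable one_ne_zero) hp)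
  have hopen : IsOpen {p : Spt | p.2 < ‖p.1‖} := isOpen_lt continuous_snd (by fun_prop)
  have hWz : ∀ p : Spt, p.2 < ‖p.1‖ → W =ᶠ[nhds p] fun _ => 0 := fun p hp => by
    filter_upwards [hopen.mem_nhds hp] with q hq
    simp [hW, hw0 q (le_of_lt hq)]
  have hz : ∀ p : Spt, p.2 < ‖p.1‖ → f p = 0 := fun p hp => by
    simp [hf, (hWz p hp).eq_of_nhds, conePow_of_le hp.le]
  have hz' : ∀ p : Spt, p.2 < ‖p.1‖ → f' p = 0 := fun p hp => by
    simp [hf', (hWz p hp).fderiv_eq, conePow_of_le hp.le]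
  have hz'' : ∀ p : Spt, p.2 < ‖p.1‖ → f'' p = 0 := fun p hp => by
    simp only [hf'']
    rw [(hWz p hp).fderiv.fderiv_eq, conePow_of_le hp.le]
    simp
  have hsm : StronglyMeasurable f' := hfL'.continuous.stronglyMeasurable
  obtain ⟨T, hT⟩ := exists_gt p.2
  have hnear : ∀ q : Spt, q.2 < T → ∀ᶠ r : Spt in nhds q, r.2 < T := fun q hq =>
    continuous_snd.continuousAt.eventually (gt_mem_nhds hq)
  have hwe : ∀ q : Spt, q.2 < T → w q = retConv (cutKer T) f q := fun q hq => by
    rw [← eq_retConv_cutKer hz hq]; exact hV q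
  have hw1 : ∀ q : Spt, q.2 < T → fderiv ℝ w q = retConv (cutKer T) f' q := fun q hq => by
    have he : w =ᶠ[nhds q] retConv (cutKer T) f := by
      filter_upwards [hnear q hq] with r hr using hwe r hr
    rw [he.fderiv_eq]
    exact (hasFDerivAt_retConv (integrable_cutKer T) hfL hfC hsm hd q).fderiv
  have hw2 : fderiv ℝ (fderiv ℝ w) p = retConv (cutKer T) f'' p := by
    have he : fderiv ℝ w =ᶠ[nhds p] retConv (cutKer T) f' := by
      filter_upwards [hnear p hT] with r hr using hw1 r hr
    rw [he.fderiv_eq]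
    exact (hasFDerivAt_retConv (integrable_cutKer T) hfL' hfC' hm'' hd' p).fderiv
  have hbox : box w p = ∫ y, (kirchConst⁻¹ * ‖y‖⁻¹) • boxL (f'' (pastCone p y)) := by
    rw [eq_retConv_cutKer (f := fun q => boxL (f'' q))
      (fun q hq => by rw [hz'' q hq, ← boxCLM_apply, map_zero]) hT, box, hw2, ← boxCLM_apply]
    unfold retConv
    refine (ContinuousLinearMap.integral_comp_comm (𝕜 := ℝ) boxCLM
      (integrable_retConv (f := f'') (integrable_cutKer T) hm'' hfC'' p)).symm.trans ?_
    simp only [map_smul, boxCLM_apply]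
  have hfar : ∀ y : E3, T < ‖y‖ → (pastCone p y).2 < ‖(pastCone p y).1‖ := fun y hy => by
    have : (pastCone p y).2 = p.2 - ‖y‖ := rfl
    have := norm_nonneg (pastCone p y).1
    linarith
  have hLP : LipschitzWith (0 + max 1 1) (pastCone p) :=
    (LipschitzWith.const p).sub (LipschitzWith.id.prodMk lipschitzWith_one_norm)
  have hkir := integral_boxL_pastCone (f := f) (D := f') (H := f'') (p := p) (R := T)
    (C := 4 * (A + C''))
    (hfL.comp hLP).locallyLipschitz (hfL'.comp hLP).locallyLipschitz
    (boxCLM.continuous.comp_stronglyMeasurable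
      (hm''.comp_measurable (continuous_pastCone p).measurable)).aestronglyMeasurable
    (fun y => (norm_boxL_le _).trans (by gcongr; exact hfC'' _))
    (fun y hy => hz _ (hfar y hy)) (fun y hy => hz' _ (hfar y hy))
    (fun y hy => by rw [hz'' _ (hfar y hy), ← boxCLM_apply, map_zero])
    (by
      filter_upwards [ae_norm_ne_of_sub p] with y hy
      refine ⟨?_, hd' _ hy⟩
      have ho : IsOpen {q : Spt | ‖q.1‖ ≠ q.2} := isOpen_ne_fun (by fun_prop) continuous_snd
      filter_upwards [ho.mem_nhds hy] with q hq using hd q hq)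
  rw [hbox]
  simp only [smul_eq_mul, mul_assoc]
  rw [integral_const_mul, hkir, ← mul_assoc, inv_mul_cancel₀ kirchConst_pos.ne', one_mul]

lemma pdt_pdt_sub_lapX {u : Spt → ℝ} {p : Spt} (hu : ContDiffAt ℝ 2 u p) :
    pdt (pdt u) p - lapX u p = box u p := by
  have ht : pdt (pdt u) p = fderiv ℝ (fderiv ℝ u) p (0, 1) (0, 1) :=
    (fderiv_fderiv_eq hu (0, 1) (0, 1)).symm
  have hmk : ∀ y : E3, HasFDerivAt (fun y : E3 => ((y, p.2) : Spt))
      (ContinuousLinearMap.inl ℝ E3 ℝ) y := fun y => hasFDerivAt_prodMk_left y p.2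
  have hslice : ∀ {G : Spt → ℝ} {y : E3} (v : E3), DifferentiableAt ℝ G (y, p.2) →
      fderiv ℝ (fun y => G (y, p.2)) y v = fderiv ℝ G (y, p.2) (v, 0) := fun {G y} v hG =>
    (DFunLike.congr_fun (hG.hasFDerivAt.comp y (hmk y)).fderiv v).trans (by simp)
  have hx : ∀ i, pd i (pd i (fixT u p.2)) p.1
      = fderiv ℝ (fderiv ℝ u) p (basis3 i, 0) (basis3 i, 0) := by
    intro i
    have hev : ∀ᶠ y in nhds p.1, DifferentiableAt ℝ u (y, p.2) :=
      ((hmk p.1).continuousAt.eventually hu.eventually_differentiableAt)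
    have he : pd i (fixT u p.2) =ᶠ[nhds p.1]
        fun y => (fun q => fderiv ℝ u q (basis3 i, 0)) (y, p.2) := by
      filter_upwards [hev] with y hy using hslice (basis3 i) hy
    rw [fderiv_fderiv_eq hu, pd, he.fderiv_eq]
    exact hslice (G := fun q => fderiv ℝ u q (basis3 i, 0)) (basis3 i)
      (hu.differentiableAt_fderiv.clm_apply (differentiableAt_const _))
  simp only [lapX, lap, ht, hx]
  rfl

/-- Existence of a global function of class `C^m` solving the Goursat problem on `D_ρ`. -/
lemma exists_contDiff_isSolOn {ρ : ℝ} (hρ : 0 < ρ) (j : ℕ) {q : E3 → ℝ}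
    (hq : ContDiffOn ℝ (3 * (j + 2) + 2 : ℕ) q (closedBall 0 ρ)) :
    ∃ u : Spt → ℝ, ContDiff ℝ (j + 2 : ℕ) u ∧ IsSolOn ρ q u := by
  obtain ⟨q', hq', hqq⟩ := exists_contDiff_extension hρ _ hq
  set m := j + 2 with hm
  have h2m : ((2:ℕ) : WithTop ℕ∞) ≤ (m : ℕ) := by norm_cast; omega
  let β : ContDiffBump (0 : Spt) := ⟨2 * ρ, 2 * ρ + 1, by linarith, by linarith⟩
  have hβ : ContDiff ℝ m β := β.contDiff
  have ha : ContDiff ℝ (m + 2 : ℕ) (transCoef q' m) :=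
    contDiff_transCoef m (m + 2) (hq'.of_le (by norm_cast; omega))
  have hqm : ContDiff ℝ m q' := hq'.of_le (by norm_cast; omega)
  set b₀ : E3 → ℝ := fun x => lapD (transCoef q' m) x + q' x * transCoef q' m x with hb₀
  have hb₀s : ContDiff ℝ m b₀ :=
    (contDiff_lapD ha).add (hqm.mul (ha.of_le (by norm_cast; omega)))
  set Q : Spt → ℝ := fun p => β p * q' p.1 with hQ
  set b : Spt → ℝ := fun p => β p * b₀ p.1 with hb
  have hQs : ContDiff ℝ m Q := hβ.mul (hqm.comp contDiff_fst)
  have hbs : ContDiff ℝ m b := hβ.mul (hb₀s.comp contDiff_fst)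
  have hQc : HasCompactSupport Q := β.hasCompactSupport.mul_right
  have hbc : HasCompactSupport b := β.hasCompactSupport.mul_right
  obtain ⟨w, hw, hw0, hV⟩ := exists_retarded_solution hQs hQc hbs hbc
  have hbox := box_of_retarded (j := j) (hQs.of_le h2m) hQc (hbs.of_le h2m) hbc (hw.of_le h2m) hw0 hV
  have hW : ContDiff ℝ m (waveSum q' m) :=
    contDiff_waveSum m m (hq'.of_le (by norm_cast; omega))
  have hu : ContDiff ℝ m fun p => waveSum q' m p + w p := hW.add hw
  refine ⟨_, hu, (hu.of_le h2m).contDiffOn, fun p hp => ?_, fun x hx => ?_⟩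
  · obtain ⟨hp1, hp2, hp3⟩ := interior_subset hp
    have hβ1 : β p = 1 := β.one_of_mem_closedBall (by
      rw [mem_closedBall_zero_iff, Prod.norm_def, max_le_iff, Real.norm_eq_abs, abs_le]
      have := norm_nonneg p.1
      change _ ≤ 2 * ρ ∧ -(2 * ρ) ≤ _ ∧ _ ≤ 2 * ρ
      refine ⟨?_, ?_, ?_⟩ <;> linarith)
    have hqp : q' p.1 = q p.1 := hqq (by simpa using hp1)
    have hcone : conePow (j + 2) b p = lor p ^ m * b₀ p.1 := by
      rcases hp2.lt_or_eq with h | h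
      · rw [conePow_of_lt h, hb]; simp [hβ1, hm]
      · rw [conePow_of_le h.ge, lor, h, sub_self, hm]; simp
    have h1 := box_waveSum m (q := q') (hq'.of_le (by norm_cast; omega)) p
    rw [pdt_pdt_sub_lapX (hu.of_le h2m).contDiffAt,
      box_add (hW.of_le h2m).contDiffAt (hw.of_le h2m).contDiffAt, hbox p, hcone, hQ]
    simp only [hβ1, ← hqp, hb₀]
    linear_combination h1
  · have hl : lor ((x, ‖x‖) : Spt) = 0 := by simp [lor]
    have h0 : waveSum q' m (x, ‖x‖) = transCoef q' 0 x := by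
      simp [waveSum, hl, Finset.sum_range_succ']
    beta_reduce
    rw [hw0 (x, ‖x‖) le_rfl, add_zero, h0]
    simp only [transCoef, radInt, pow_zero, one_smul]
    refine intervalIntegral.integral_congr fun σ hσ => hqq ?_
    rw [uIcc_of_le zero_le_one] at hσ
    rw [mem_closedBall_zero_iff, norm_smul, Real.norm_of_nonneg hσ.1]
    nlinarith [hσ.2, norm_nonneg x]

lemma box_congr {f g : Spt → ℝ} {p : Spt} (h : f =ᶠ[nhds p] g) : box f p = box g p := by
  unfold box
  rw [h.fderiv.fderiv_eq]

lemma box_zero (p : Spt) : box (fun _ => 0) p = 0 := by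
  have h : fderiv ℝ (fun _ : Spt => (0:ℝ)) = fun _ => 0 := funext fun q => fderiv_const_apply 0
  rw [box, h, fderiv_fun_const, Pi.zero_apply, ← boxCLM_apply, map_zero]

lemma ContDiffAt.continuousAt_box {f : Spt → ℝ} {p : Spt} (hf : ContDiffAt ℝ 2 f p) :
    ContinuousAt (box f) p := by
  have h1 : ContDiffAt ℝ 1 (fderiv ℝ f) p := hf.fderiv_right (by norm_num)
  have h2 : ContDiffAt ℝ 0 (fderiv ℝ (fderiv ℝ f)) p := h1.fderiv_right (by norm_num)
  exact boxCLM.continuous.continuousAt.comp h2.continuousAt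

lemma lipschitzWith_pastCone (p : Spt) : LipschitzWith (0 + max 1 1) (pastCone p) :=
  (LipschitzWith.const p).sub (LipschitzWith.id.prodMk lipschitzWith_one_norm)

lemma locallyLipschitz_comp_pastCone {F : Type} [NormedAddCommGroup F] [NormedSpace ℝ F]
    {f : Spt → F} {p : Spt} (hf : ∀ y, ContDiffAt ℝ 1 f (pastCone p y)) :
    LocallyLipschitz fun y => f (pastCone p y) := by
  intro y
  obtain ⟨K, t, ht, h⟩ := (hf y).exists_lipschitzOnWith
  refine ⟨_, _, (continuous_pastCone p).continuousAt.preimage_mem_nhds ht,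
    h.comp ((lipschitzWith_pastCone p).lipschitzOnWith (s := pastCone p ⁻¹' t))
      (mapsTo_preimage _ _)⟩

lemma deriv_deriv_originCut_of_gt {s : ℝ} (hs : 2 < s) : deriv (deriv originCut) s = 0 := by
  have : deriv originCut =ᶠ[nhds s] fun _ => (0:ℝ) := by
    filter_upwards [Ioi_mem_nhds hs] with z hz using deriv_originCut_of_gt hz
  rw [this.deriv_eq, deriv_const]

lemma exists_mul_deriv_deriv_originCut_le :
    ∃ M, ∀ s, |s * deriv (deriv originCut) s| ≤ M := by
  have hc : Continuous (deriv (deriv originCut)) := by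
    have h : ContDiff ℝ (1 + 1) originCut := contDiff_originCut (n := 2)
    exact ((contDiff_succ_iff_deriv.1 h).2.2).continuous_deriv le_rfl
  refine (continuous_id.mul hc).bounded_above_of_compact_support ?_
  refine HasCompactSupport.of_support_subset_isCompact (isCompact_Icc (a := (1:ℝ)) (b := 2)) ?_
  intro s hs
  by_contra h
  rw [mem_Icc, not_and_or, not_le, not_le] at h
  refine hs ?_
  rcases h with h | h
  · have : deriv originCut =ᶠ[nhds s] fun _ => (0:ℝ) := by
      filter_upwards [Iio_mem_nhds h] with z hz using deriv_originCut_of_lt hz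
    change s * deriv (deriv originCut) s = 0
    rw [this.deriv_eq, deriv_const, mul_zero]
  · change s * deriv (deriv originCut) s = 0
    rw [deriv_deriv_originCut_of_gt h, mul_zero]

/-- `f` restricted to the forward cone and cut off smoothly near its boundary. -/
def coneCut (c : ℝ) (f : Spt → ℝ) : Spt → ℝ :=
  {p : Spt | ‖p.1‖ < p.2}.indicator fun p => originCut (c * lor p) * f p

lemma coneCut_eventuallyEq {c : ℝ} {f : Spt → ℝ} {p : Spt} (hp : ‖p.1‖ < p.2) :
    coneCut c f =ᶠ[nhds p] fun p => originCut (c * lor p) * f p := by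
  filter_upwards [isOpen_cone.mem_nhds hp] with q hq using
    indicator_of_mem (s := {p : Spt | ‖p.1‖ < p.2}) hq _

lemma coneCut_eventuallyEq_zero {c : ℝ} {f : Spt → ℝ} {p : Spt} (hp : p.2 ≤ ‖p.1‖) :
    coneCut c f =ᶠ[nhds p] fun _ => 0 := by
  rcases hp.lt_or_eq with h | h
  · have ho : IsOpen {p : Spt | p.2 < ‖p.1‖} := isOpen_lt continuous_snd continuous_fst.norm
    filter_upwards [ho.mem_nhds h] with q hq
    exact indicator_of_notMem (s := {p : Spt | ‖p.1‖ < p.2}) (fun h' => lt_asymm hq h') _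
  · have hl : c * lor p < 1 := by simp [lor, h]
    have hc : Continuous fun q => c * lor q := continuous_const.mul (contDiff_lor (n := 0)).continuous
    filter_upwards [(isOpen_lt hc continuous_const).mem_nhds hl] with q hq
    unfold coneCut
    rw [indicator_apply_eq_zero]
    intro _
    rw [originCut_of_le (le_of_lt hq), zero_mul]

lemma contDiff_originCut_mul (c : ℝ) : ContDiff ℝ 2 fun s => originCut (c * s) :=
  (contDiff_originCut (n := 2)).comp (contDiff_const.mul contDiff_id)

lemma deriv_originCut_mul (c s : ℝ) :
    deriv (fun s => originCut (c * s)) s = c * deriv originCut (c * s) := by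
  have h := (hasDerivAt_originCut (c * s)).comp s ((hasDerivAt_id s).const_mul c)
  exact h.deriv.trans (by ring)

lemma deriv_deriv_originCut_mul (c s : ℝ) :
    deriv (deriv fun s => originCut (c * s)) s = c ^ 2 * deriv (deriv originCut) (c * s) := by
  have hd : Differentiable ℝ (deriv originCut) := by
    have h : ContDiff ℝ (1 + 1) originCut := contDiff_originCut (n := 2)
    exact ((contDiff_succ_iff_deriv.1 h).2.2).differentiable one_ne_zero
  rw [funext (deriv_originCut_mul c)]
  have h := ((hd (c * s)).hasDerivAt.comp s ((hasDerivAt_id s).const_mul c)).const_mul c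
  exact h.deriv.trans (by ring)

lemma contDiffAt_coneCut {c : ℝ} {f : Spt → ℝ} {p : Spt}
    (hf : ‖p.1‖ < p.2 → ContDiffAt ℝ 2 f p) : ContDiffAt ℝ 2 (coneCut c f) p := by
  rcases lt_or_ge ‖p.1‖ p.2 with h | h
  · exact (((contDiff_originCut_mul c).comp contDiff_lor).contDiffAt.mul
      (hf h)).congr_of_eventuallyEq (coneCut_eventuallyEq h)
  · exact contDiffAt_const.congr_of_eventuallyEq (coneCut_eventuallyEq_zero h)

lemma box_coneCut {c : ℝ} {f : Spt → ℝ} {p : Spt} (hp : ‖p.1‖ < p.2)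
    (hf : ContDiffAt ℝ 2 f p) :
    box (coneCut c f) p = originCut (c * lor p) * box f p
      + c * (4 * (c * lor p * deriv (deriv originCut) (c * lor p))
        + 8 * deriv originCut (c * lor p)) * f p
      + 4 * (c * deriv originCut (c * lor p)) * fderiv ℝ f p p := by
  rw [box_congr (coneCut_eventuallyEq hp),
    box_comp_lor_mul (χ := fun s => originCut (c * s)) (contDiff_originCut_mul c) hf,
    deriv_deriv_originCut_mul, deriv_originCut_mul]
  ring

lemma box_coneCut_of_le {c : ℝ} {f : Spt → ℝ} {p : Spt} (hp : p.2 ≤ ‖p.1‖) :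
    box (coneCut c f) p = 0 :=
  (box_congr (coneCut_eventuallyEq_zero hp)).trans (box_zero p)

lemma box_coneCut_of_gt {c : ℝ} {f : Spt → ℝ} {p : Spt} (hp : ‖p.1‖ < p.2)
    (hf : ContDiffAt ℝ 2 f p) (hc : 2 < c * lor p) : box (coneCut c f) p = box f p := by
  rw [box_coneCut hp hf, originCut_of_ge hc.le, deriv_originCut_of_gt hc,
    deriv_deriv_originCut_of_gt hc]
  ring

/-- The box of `coneCut c f` is bounded uniformly in `c` away from the vertex of the cone, as soon
as `f` and its scaling derivative vanish to first order on the boundary. -/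
lemma exists_box_coneCut_le {a C : ℝ} (ha : 0 < a) :
    ∃ B, 0 ≤ B ∧ ∀ (c : ℝ) (f : Spt → ℝ) (p : Spt), 0 < c → a ≤ p.2 + ‖p.1‖ →
      (‖p.1‖ < p.2 → ContDiffAt ℝ 2 f p ∧ |f p| ≤ C * (p.2 - ‖p.1‖) ∧
        |fderiv ℝ f p p| ≤ C * (p.2 - ‖p.1‖) ∧ |box f p| ≤ C) →
      |box (coneCut c f) p| ≤ B := by
  obtain ⟨M, hM⟩ := exists_deriv_originCut_le
  obtain ⟨N, hN⟩ := exists_mul_deriv_deriv_originCut_le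
  have hM0 : 0 ≤ M := (norm_nonneg _).trans (hM 0)
  have hN0 : 0 ≤ N := (abs_nonneg _).trans (hN 0)
  refine ⟨|C| + (4 * N + 12 * M) * (|C| * (2 / a)), by positivity, fun c f p hc hap h => ?_⟩
  rcases lt_or_ge ‖p.1‖ p.2 with hp | hp
  swap
  · rw [box_coneCut_of_le hp, abs_zero]; positivity
  obtain ⟨h2, hf, hd, hb⟩ := h hp
  have hb' : |box f p| ≤ |C| := hb.trans (le_abs_self C)
  rcases lt_or_ge 2 (c * lor p) with hl | hl
  · rw [box_coneCut_of_gt hp h2 hl]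
    exact hb'.trans (le_add_of_nonneg_right (by positivity))
  rw [box_coneCut hp h2]
  have hd0 : 0 < p.2 - ‖p.1‖ := sub_pos.2 hp
  have hcd : c * (p.2 - ‖p.1‖) ≤ 2 / a := by
    rw [le_div_iff₀ ha]
    refine le_trans ?_ hl
    have : c * lor p = c * (p.2 - ‖p.1‖) * (p.2 + ‖p.1‖) := by rw [lor]; ring
    rw [this]
    exact mul_le_mul_of_nonneg_left hap (by positivity)
  have key : ∀ x, |x| ≤ C * (p.2 - ‖p.1‖) → c * |x| ≤ |C| * (2 / a) := fun x hx =>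
    calc c * |x| ≤ c * (|C| * (p.2 - ‖p.1‖)) := by
          refine mul_le_mul_of_nonneg_left (hx.trans ?_) hc.le
          exact mul_le_mul_of_nonneg_right (le_abs_self C) hd0.le
      _ = |C| * (c * (p.2 - ‖p.1‖)) := by ring
      _ ≤ _ := mul_le_mul_of_nonneg_left hcd (abs_nonneg _)
  have hM' : |deriv originCut (c * lor p)| ≤ M := hM _
  have e1 : |originCut (c * lor p) * box f p| ≤ |C| := by
    rw [abs_mul]
    exact (mul_le_of_le_one_left (abs_nonneg _) (abs_originCut_le _)).trans hb'
  have e2 : |c * (4 * (c * lor p * deriv (deriv originCut) (c * lor p))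
        + 8 * deriv originCut (c * lor p)) * f p| ≤ (4 * N + 8 * M) * (|C| * (2 / a)) := by
    rw [mul_comm c, mul_assoc, abs_mul, abs_mul c, abs_of_pos hc]
    refine mul_le_mul ?_ (key _ hf) (by positivity) (by positivity)
    refine (abs_add_le _ _).trans ?_
    rw [abs_mul, abs_mul 8, abs_of_pos (by norm_num : (0:ℝ) < 4), abs_of_pos (by norm_num : (0:ℝ) < 8)]
    have := hN (c * lor p)
    gcongr
  have e3 : |4 * (c * deriv originCut (c * lor p)) * fderiv ℝ f p p|
      ≤ 4 * M * (|C| * (2 / a)) := by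
    have : 4 * (c * deriv originCut (c * lor p)) * fderiv ℝ f p p
      = 4 * deriv originCut (c * lor p) * (c * fderiv ℝ f p p) := by ring
    rw [this, abs_mul, abs_mul 4, abs_mul c, abs_of_pos hc, abs_of_pos (by norm_num : (0:ℝ) < 4)]
    refine mul_le_mul ?_ (key _ hd) (by positivity) (by positivity)
    gcongr
  refine (abs_add_le _ _).trans ?_
  have := abs_add_le (originCut (c * lor p) * box f p)
    (c * (4 * (c * lor p * deriv (deriv originCut) (c * lor p))
        + 8 * deriv originCut (c * lor p)) * f p)
  linarith

/-- Kirchhoff's formula for a function in the forward cone that vanishes, together with its scaling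
derivative, to first order on the boundary. -/
lemma integral_box_of_vanishing {f : Spt → ℝ} {p : Spt} {C : ℝ} (hp : ‖p.1‖ < p.2)
    (hf : ∀ y, ‖(pastCone p y).1‖ < (pastCone p y).2 → ContDiffAt ℝ 2 f (pastCone p y) ∧
      |f (pastCone p y)| ≤ C * ((pastCone p y).2 - ‖(pastCone p y).1‖) ∧
      |fderiv ℝ f (pastCone p y) (pastCone p y)|
        ≤ C * ((pastCone p y).2 - ‖(pastCone p y).1‖) ∧ |box f (pastCone p y)| ≤ C) :
    ∫ y, ‖y‖⁻¹ * {z : Spt | ‖z.1‖ < z.2}.indicator (box f) (pastCone p y) = kirchConst * f p := by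
  have hfar : ∀ y : E3, p.2 < ‖y‖ → (pastCone p y).2 ≤ ‖(pastCone p y).1‖ := fun y hy => by
    have : (pastCone p y).2 = p.2 - ‖y‖ := rfl
    have := norm_nonneg (pastCone p y).1
    linarith
  have hsum : ∀ y, p.2 - ‖p.1‖ ≤ (pastCone p y).2 + ‖(pastCone p y).1‖ := fun y => by
    have h1 : (pastCone p y).2 = p.2 - ‖y‖ := rfl
    have h2 : (pastCone p y).1 = p.1 - y := rfl
    have := norm_sub_norm_le y p.1
    rw [norm_sub_rev] at this
    rw [h1, h2]; linarith
  obtain ⟨B, hB0, hB⟩ := exists_box_coneCut_le (C := C) (sub_pos.2 hp)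
  have hbd : ∀ (n : ℕ) y, |box (coneCut (n + 1) f) (pastCone p y)| ≤ B := fun n y =>
    hB _ _ _ (by positivity) (hsum y) (hf y)
  have h2 : ∀ (n : ℕ) y, ContDiffAt ℝ 2 (coneCut (n + 1) f) (pastCone p y) := fun n y =>
    contDiffAt_coneCut fun h => (hf y h).1
  have hbc : ∀ n : ℕ, Continuous fun y => box (coneCut (n + 1) f) (pastCone p y) := fun n =>
    continuous_iff_continuousAt.2 fun y => by
      have := (h2 n y).continuousAt_box
      exact this.comp (continuous_pastCone p).continuousAt
  have hrep : ∀ n : ℕ, ∫ y, ‖y‖⁻¹ * box (coneCut (n + 1) f) (pastCone p y)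
      = kirchConst * coneCut (n + 1) f p := fun n =>
    integral_boxL_pastCone (f := coneCut (n + 1) f) (D := fderiv ℝ (coneCut (n + 1) f))
      (H := fderiv ℝ (fderiv ℝ (coneCut (n + 1) f))) (R := p.2) (C := B)
      (locallyLipschitz_comp_pastCone fun y => (h2 n y).of_le (by norm_num))
      (locallyLipschitz_comp_pastCone fun y => (h2 n y).fderiv_right (by norm_num))
      (hbc n).aestronglyMeasurable (hbd n)
      (fun y hy => (coneCut_eventuallyEq_zero (hfar y hy)).eq_of_nhds)
      (fun y hy => by
        rw [(coneCut_eventuallyEq_zero (hfar y hy)).fderiv_eq, fderiv_const_apply])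
      (fun y hy => box_coneCut_of_le (hfar y hy))
      (ae_of_all _ fun y => ⟨(h2 n y).eventually_differentiableAt.mono fun q hq => hq.hasFDerivAt,
        (h2 n y).differentiableAt_fderiv.hasFDerivAt⟩)
  have hev : ∀ z : Spt, ‖z.1‖ < z.2 → ∀ᶠ n : ℕ in Filter.atTop, 2 < ((n:ℝ) + 1) * lor z := by
    intro z hz
    have hl : 0 < lor z := by
      have := norm_nonneg z.1
      rw [lor]; nlinarith
    have h1 : Filter.Tendsto (fun n : ℕ => ((n:ℝ) + 1) * lor z) Filter.atTop Filter.atTop :=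
      (Filter.tendsto_atTop_add_const_right _ _ tendsto_natCast_atTop_atTop).atTop_mul_const hl
    exact h1.eventually_gt_atTop 2
  have hlim : Filter.Tendsto (fun n : ℕ => ∫ y, ‖y‖⁻¹ * box (coneCut (n + 1) f) (pastCone p y))
      Filter.atTop (nhds (∫ y, ‖y‖⁻¹ *
        {z : Spt | ‖z.1‖ < z.2}.indicator (box f) (pastCone p y))) := by
    refine tendsto_integral_of_dominated_convergence
      (fun y => (closedBall (0:E3) p.2).indicator (fun y => ‖y‖⁻¹) y * B)
      (fun n => (measurable_norm.inv.aestronglyMeasurable.mul (hbc n).aestronglyMeasurable))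
      ((norm_inv_integrableOn p.2).mul_const B) (fun n => ae_of_all _ fun y => ?_)
      (ae_of_all _ fun y => ?_)
    · rw [norm_mul, norm_inv, norm_norm, Real.norm_eq_abs]
      rcases le_or_gt ‖y‖ p.2 with h | h
      · rw [indicator_of_mem (by simpa using h)]
        exact mul_le_mul_of_nonneg_left (hbd n y) (by positivity)
      · rw [box_coneCut_of_le (hfar y h), abs_zero, mul_zero]
        exact mul_nonneg (indicator_nonneg (fun _ _ => by positivity) _) hB0
    · refine Filter.Tendsto.const_mul _ ?_
      refine tendsto_const_nhds.congr' ?_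
      rcases lt_or_ge ‖(pastCone p y).1‖ (pastCone p y).2 with h | h
      · filter_upwards [hev _ h] with n hn
        rw [indicator_of_mem (by exact h), box_coneCut_of_gt h (hf y h).1 hn]
      · filter_upwards with n
        rw [indicator_of_notMem (by simpa using h), box_coneCut_of_le h]
  simp only [hrep] at hlim
  refine tendsto_nhds_unique hlim (Filter.Tendsto.const_mul _ (tendsto_const_nhds.congr' ?_))
  filter_upwards [hev p hp] with n hn
  rw [(coneCut_eventuallyEq hp).eq_of_nhds, originCut_of_ge hn.le, one_mul]

lemma mem_interior_Dcone {ρ : ℝ} {p : Spt} :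
    p ∈ interior (Dcone ρ) ↔ ‖p.1‖ < p.2 ∧ p.2 + ‖p.1‖ < 2 * ρ := by
  constructor
  · intro hp
    obtain ⟨ε, hε, h⟩ := Metric.isOpen_iff.1 isOpen_interior p hp
    have hmem : ∀ s : ℝ, |s| < ε → ((p.1, p.2 + s) : Spt) ∈ Dcone ρ := fun s hs =>
      interior_subset (h (by
        rw [mem_ball, Prod.dist_eq, dist_self, Real.dist_eq, add_sub_cancel_left]
        exact max_lt hε hs))
    obtain ⟨-, -, h1⟩ := hmem (ε / 2) (by rw [abs_of_pos (half_pos hε)]; linarith)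
    obtain ⟨-, h2, -⟩ := hmem (-(ε / 2)) (by rw [abs_neg, abs_of_pos (half_pos hε)]; linarith)
    dsimp only at h1 h2
    constructor <;> linarith
  · intro hp
    have ho : IsOpen ({p : Spt | ‖p.1‖ < p.2} ∩ {p : Spt | p.2 + ‖p.1‖ < 2 * ρ}) :=
      isOpen_cone.inter (isOpen_lt (continuous_snd.add continuous_fst.norm) continuous_const)
    refine interior_maximal (fun q hq => ?_) ho hp
    obtain ⟨h1, h2⟩ := hq
    rw [mem_ofPred_eq] at h1 h2
    exact ⟨by linarith, h1.le, by linarith⟩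

lemma isCompact_Dcone (ρ : ℝ) : IsCompact (Dcone ρ) := by
  have hcl : IsClosed (Dcone ρ) :=
    (isClosed_le continuous_fst.norm continuous_const).inter
      ((isClosed_le continuous_fst.norm continuous_snd).inter
        (isClosed_le continuous_snd (continuous_const.sub continuous_fst.norm)))
  refine (isCompact_closedBall (0:Spt) (2 * ρ)).of_isClosed_subset hcl fun p hp => ?_
  obtain ⟨h1, h2, h3⟩ := hp
  have := norm_nonneg p.1
  rw [mem_closedBall_zero_iff, Prod.norm_def, max_le_iff, Real.norm_eq_abs, abs_le]
  refine ⟨?_, ?_, ?_⟩ <;> linarith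

lemma convex_Dcone (ρ : ℝ) : Convex ℝ (Dcone ρ) := by
  rintro p ⟨h1, h2, h3⟩ q ⟨h4, h5, h6⟩ a b ha hb hab
  have hn : ‖(a • p + b • q).1‖ ≤ a * ‖p.1‖ + b * ‖q.1‖ := by
    refine (norm_add_le _ _).trans ?_
    rw [Prod.smul_fst, Prod.smul_fst, norm_smul, norm_smul, Real.norm_of_nonneg ha,
      Real.norm_of_nonneg hb]
  have ht : (a • p + b • q).2 = a * p.2 + b * q.2 := rfl
  have hρ : ρ = a * ρ + b * ρ := by rw [← add_mul, hab, one_mul]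
  have e1 := mul_le_mul_of_nonneg_left h1 ha
  have e2 := mul_le_mul_of_nonneg_left h2 ha
  have e3 := mul_le_mul_of_nonneg_left h3 ha
  have e4 := mul_le_mul_of_nonneg_left h4 hb
  have e5 := mul_le_mul_of_nonneg_left h5 hb
  have e6 := mul_le_mul_of_nonneg_left h6 hb
  rw [mul_sub] at e3 e6
  refine ⟨?_, ?_, ?_⟩
  · linarith
  · linarith
  · rw [ht]; linarith

lemma nonempty_interior_Dcone {ρ : ℝ} (hρ : 0 < ρ) : (interior (Dcone ρ)).Nonempty :=
  ⟨(0, ρ), mem_interior_Dcone.2 ⟨by simpa using hρ, by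
    simp only [norm_zero, add_zero]; linarith⟩⟩

lemma closure_interior_Dcone {ρ : ℝ} (hρ : 0 < ρ) : closure (interior (Dcone ρ)) = Dcone ρ := by
  rw [(convex_Dcone ρ).closure_interior_eq_closure_of_nonempty_interior
    (nonempty_interior_Dcone hρ), (isCompact_Dcone ρ).isClosed.closure_eq]

lemma uniqueDiffOn_Dcone {ρ : ℝ} (hρ : 0 < ρ) : UniqueDiffOn ℝ (Dcone ρ) :=
  uniqueDiffOn_convex (convex_Dcone ρ) (nonempty_interior_Dcone hρ)

lemma exists_abs_le_of_eq_zero_on_cone {ρ : ℝ} {g : Spt → ℝ} (hg : ContDiffOn ℝ 1 g (Dcone ρ))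
    (h0 : ∀ x : E3, ‖x‖ ≤ ρ → g (x, ‖x‖) = 0) :
    ∃ K, 0 ≤ K ∧ ∀ z ∈ Dcone ρ, |g z| ≤ K * (z.2 - ‖z.1‖) := by
  obtain ⟨K, hK⟩ := (hg.locallyLipschitzOn (convex_Dcone ρ)).exists_lipschitzOnWith_of_compact
    (isCompact_Dcone ρ)
  refine ⟨K, K.2, fun z hz => ?_⟩
  have hz' : ((z.1, ‖z.1‖) : Spt) ∈ Dcone ρ := ⟨hz.1, le_rfl, hz.2.1.trans hz.2.2⟩
  have h := hK.dist_le_mul z hz _ hz'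
  rwa [h0 z.1 hz.1, dist_zero_right, Real.norm_eq_abs, Prod.dist_eq, dist_self, Real.dist_eq,
    abs_of_nonneg (sub_nonneg.2 hz.2.1), max_eq_right (sub_nonneg.2 hz.2.1)] at h

lemma fderivWithin_radial_eq_zero {ρ : ℝ} {v : Spt → ℝ}
    (hv : ContDiffOn ℝ 2 v (Dcone ρ)) (h0 : ∀ x : E3, ‖x‖ ≤ ρ → v (x, ‖x‖) = 0) {x : E3}
    (hx : ‖x‖ ≤ ρ) : fderivWithin ℝ v (Dcone ρ) (x, ‖x‖) (x, ‖x‖) = 0 := by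
  have hmem : ∀ x : E3, ‖x‖ ≤ ρ → ((x, ‖x‖) : Spt) ∈ Dcone ρ := fun x hx =>
    ⟨hx, le_rfl, by change ‖x‖ ≤ 2 * ρ - ‖x‖; linarith⟩
  have hs : ∀ s ∈ Icc (0:ℝ) 1, ‖s • x‖ ≤ ρ ∧ s • ((x, ‖x‖) : Spt) = (s • x, ‖s • x‖) := by
    intro s hs
    have : ‖s • x‖ = s * ‖x‖ := by rw [norm_smul, Real.norm_of_nonneg hs.1]
    refine ⟨?_, by rw [this]; rfl⟩
    rw [this]
    exact (mul_le_of_le_one_left (norm_nonneg x) hs.2).trans hx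
  have hd : HasFDerivWithinAt v (fderivWithin ℝ v (Dcone ρ) (x, ‖x‖)) (Dcone ρ)
      ((1:ℝ) • ((x, ‖x‖) : Spt)) := by
    rw [one_smul]
    exact (hv.differentiableOn two_ne_zero _ (hmem x hx)).hasFDerivWithinAt
  have hγ : HasDerivWithinAt (fun s : ℝ => s • ((x, ‖x‖) : Spt)) ((1:ℝ) • ((x, ‖x‖) : Spt))
      (Icc 0 1) 1 := ((hasDerivAt_id (1:ℝ)).smul_const _).hasDerivWithinAt
  have h1 := HasFDerivWithinAt.comp_hasDerivWithinAt (1:ℝ) hd hγ fun s h => by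
    rw [(hs s h).2]; exact hmem _ (hs s h).1
  have h2 : HasDerivWithinAt (v ∘ fun s : ℝ => s • ((x, ‖x‖) : Spt)) 0 (Icc 0 1) 1 := by
    refine (hasDerivWithinAt_const (1:ℝ) (Icc (0:ℝ) 1) (0:ℝ)).congr_of_mem (fun s h => ?_)
      (right_mem_Icc.2 zero_le_one)
    change v (s • ((x, ‖x‖) : Spt)) = 0
    rw [(hs s h).2]
    exact h0 _ (hs s h).1
  have hu : UniqueDiffWithinAt ℝ (Icc (0:ℝ) 1) 1 :=
    uniqueDiffOn_Icc zero_lt_one 1 (right_mem_Icc.2 zero_le_one)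
  have h3 := hu.eq_deriv _ h1 h2
  rwa [one_smul] at h3

lemma box_sub {f g : Spt → ℝ} {p : Spt} (hf : ContDiffAt ℝ 2 f p) (hg : ContDiffAt ℝ 2 g p) :
    box (fun q => f q - g q) p = box f p - box g p := by
  have he : fderiv ℝ (fun q => f q - g q) =ᶠ[nhds p] fun q => fderiv ℝ f q - fderiv ℝ g q := by
    filter_upwards [hf.eventually_differentiableAt, hg.eventually_differentiableAt] with q h1 h2
    exact fderiv_fun_sub h1 h2
  unfold box
  rw [he.fderiv_eq, fderiv_fun_sub hf.differentiableAt_fderiv hg.differentiableAt_fderiv]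
  exact map_sub boxCLM _ _

lemma pastCone_mem_interior_Dcone {ρ : ℝ} {p : Spt} (hp : p ∈ interior (Dcone ρ)) {y : E3}
    (hy : ‖(pastCone p y).1‖ < (pastCone p y).2) : pastCone p y ∈ interior (Dcone ρ) := by
  rw [mem_interior_Dcone] at hp ⊢
  refine ⟨hy, lt_of_le_of_lt ?_ hp.2⟩
  have h1 : (pastCone p y).2 = p.2 - ‖y‖ := rfl
  have h2 : (pastCone p y).1 = p.1 - y := rfl
  have := norm_sub_le p.1 y
  rw [h1, h2]
  linarith

/-- A Gronwall inequality for retarded potentials. -/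
lemma eq_zero_of_kirchhoff {ρ S M : ℝ} {v b : Spt → ℝ} (hM : 0 ≤ M)
    (hS : ∀ z ∈ interior (Dcone ρ), |v z| ≤ S) (hb : ∀ z ∈ interior (Dcone ρ), |b z| ≤ M * |v z|)
    (hv : ∀ p ∈ interior (Dcone ρ),
      ∫ y, ‖y‖⁻¹ * {z : Spt | ‖z.1‖ < z.2}.indicator b (pastCone p y) = kirchConst * v p)
    {p : Spt} (hp : p ∈ interior (Dcone ρ)) : v p = 0 := by
  obtain ⟨Λ, hΛ, hδ⟩ := exists_integral_expKer_le (δ := (2 * (M + 1))⁻¹) (by positivity)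
  have hS0 : 0 ≤ S := (abs_nonneg _).trans (hS p hp)
  have key : ∀ n : ℕ, ∀ p ∈ interior (Dcone ρ), |v p| ≤ S * (1 / 2) ^ n * exp (Λ * p.2) := by
    intro n
    induction n with
    | zero =>
      intro p hp
      rw [pow_zero, mul_one]
      have hp' := (mem_interior_Dcone.1 hp).1
      have h0 : 0 ≤ Λ * p.2 := mul_nonneg (by linarith) ((norm_nonneg _).trans hp'.le)
      exact (hS p hp).trans (le_mul_of_one_le_right hS0 (one_le_exp h0))
    | succ n ih =>
      intro p hp
      have e : v p = ∫ y, kirchConst⁻¹ *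
          (‖y‖⁻¹ * {z : Spt | ‖z.1‖ < z.2}.indicator b (pastCone p y)) := by
        rw [integral_const_mul, hv p hp, inv_mul_cancel_left₀ kirchConst_pos.ne']
      set c := M * (S * (1 / 2) ^ n) * exp (Λ * p.2) with hc
      have hc0 : 0 ≤ c := by positivity
      have hle : |v p| ≤ ∫ y, ‖expKer Λ y‖ * c := by
        rw [e, ← Real.norm_eq_abs]
        refine norm_integral_le_of_norm_le ((integrable_expKer hΛ).norm.mul_const c)
          (ae_of_all _ fun y => ?_)
        by_cases h : ‖(pastCone p y).1‖ < (pastCone p y).2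
        · have hz := pastCone_mem_interior_Dcone hp h
          rw [indicator_of_mem (by exact h), Real.norm_of_nonneg (expKer_nonneg Λ y), expKer,
            norm_mul, norm_mul, norm_inv, norm_inv, norm_norm,
            Real.norm_of_nonneg kirchConst_pos.le, Real.norm_eq_abs]
          have hz2 : (pastCone p y).2 = p.2 - ‖y‖ := rfl
          have hexp : exp (Λ * (pastCone p y).2) = exp (-Λ * ‖y‖) * exp (Λ * p.2) := by
            rw [hz2, ← exp_add]; ring_nf
          calc kirchConst⁻¹ * (‖y‖⁻¹ * |b (pastCone p y)|)
              ≤ kirchConst⁻¹ * (‖y‖⁻¹ * (M * (S * (1 / 2) ^ n * exp (Λ * (pastCone p y).2)))) := by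
                have := kirchConst_pos
                gcongr
                exact (hb _ hz).trans (mul_le_mul_of_nonneg_left (ih _ hz) hM)
            _ = _ := by rw [hexp, hc]; ring
        · rw [indicator_of_notMem (by exact h), mul_zero, mul_zero, norm_zero]
          positivity
      refine hle.trans ?_
      rw [integral_mul_const]
      calc (∫ y, ‖expKer Λ y‖) * c ≤ (2 * (M + 1))⁻¹ * c := mul_le_mul_of_nonneg_right hδ hc0
        _ = M / (M + 1) * (S * (1 / 2) ^ (n + 1) * exp (Λ * p.2)) := by
            rw [hc]; field_simp; ring
        _ ≤ 1 * (S * (1 / 2) ^ (n + 1) * exp (Λ * p.2)) := by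
            refine mul_le_mul_of_nonneg_right ?_ (by positivity)
            rw [div_le_one (by positivity)]; linarith
        _ = _ := one_mul _
  have hlim : Filter.Tendsto (fun n : ℕ => S * (1 / 2 : ℝ) ^ n * exp (Λ * p.2)) Filter.atTop
      (nhds 0) := by
    have := ((tendsto_pow_atTop_nhds_zero_of_lt_one (by norm_num : (0:ℝ) ≤ 1 / 2)
      (by norm_num)).const_mul S).mul_const (exp (Λ * p.2))
    simpa using this
  exact abs_eq_zero.1 (le_antisymm (ge_of_tendsto' hlim fun n => key n p hp) (abs_nonneg _))

lemma eqOn_of_isSolOn {ρ : ℝ} (hρ : 0 < ρ) {q : E3 → ℝ} (hq : ContinuousOn q (closedBall 0 ρ))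
    {u u' : Spt → ℝ} (hu : IsSolOn ρ q u) (hu' : IsSolOn ρ q u') : EqOn u u' (Dcone ρ) := by
  set v : Spt → ℝ := fun p => u p - u' p with hvdef
  have hv : ContDiffOn ℝ 2 v (Dcone ρ) := hu.1.sub hu'.1
  have hv0 : ∀ x : E3, ‖x‖ ≤ ρ → v (x, ‖x‖) = 0 := fun x hx => by
    rw [hvdef]; simp only [hu.2.2 x hx, hu'.2.2 x hx, sub_self]
  have hint : ∀ {z}, z ∈ interior (Dcone ρ) → Dcone ρ ∈ nhds z := fun hz =>
    mem_interior_iff_mem_nhds.1 hz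
  have hbox : ∀ z ∈ interior (Dcone ρ), box v z = q z.1 * v z := fun z hz => by
    have h1 := hu.1.contDiffAt (hint hz)
    have h2 := hu'.1.contDiffAt (hint hz)
    have e1 := hu.2.1 z hz
    have e2 := hu'.2.1 z hz
    rw [pdt_pdt_sub_lapX h1] at e1
    rw [pdt_pdt_sub_lapX h2] at e2
    rw [hvdef, box_sub h1 h2]
    linear_combination e1 - e2
  obtain ⟨M, hM⟩ := (isCompact_closedBall (0:E3) ρ).exists_bound_of_continuousOn hq
  obtain ⟨S, hS⟩ := (isCompact_Dcone ρ).exists_bound_of_continuousOn hv.continuousOn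
  have hM0 : 0 ≤ M := (norm_nonneg _).trans (hM 0 (mem_closedBall_self hρ.le))
  obtain ⟨K, hK0, hK⟩ := exists_abs_le_of_eq_zero_on_cone (hv.of_le (by norm_num)) hv0
  obtain ⟨L, hL0, hL⟩ := exists_abs_le_of_eq_zero_on_cone
    (g := fun z => fderivWithin ℝ v (Dcone ρ) z z)
    ((hv.fderivWithin (uniqueDiffOn_Dcone hρ) (by norm_num)).clm_apply contDiffOn_id)
    fun x hx => fderivWithin_radial_eq_zero hv hv0 hx
  have hbq : ∀ z ∈ interior (Dcone ρ), |box v z| ≤ M * |v z| := fun z hz => by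
    rw [hbox z hz, abs_mul]
    exact mul_le_mul_of_nonneg_right
      (hM z.1 (by simpa using (interior_subset hz).1)) (abs_nonneg _)
  have hS0 : 0 ≤ S := (norm_nonneg _).trans (hS _ (interior_subset
    (nonempty_interior_Dcone hρ).some_mem))
  have hkirch : ∀ p ∈ interior (Dcone ρ),
      ∫ y, ‖y‖⁻¹ * {z : Spt | ‖z.1‖ < z.2}.indicator (box v) (pastCone p y)
        = kirchConst * v p := fun p hp => by
    refine integral_box_of_vanishing (C := K + L + M * S) (mem_interior_Dcone.1 hp).1
      fun y hy => ?_
    have hz := pastCone_mem_interior_Dcone hp hy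
    have hzD := interior_subset hz
    have hd : 0 ≤ (pastCone p y).2 - ‖(pastCone p y).1‖ := sub_nonneg.2 hy.le
    have hMS : 0 ≤ M * S := mul_nonneg hM0 hS0
    refine ⟨hv.contDiffAt (hint hz), (hK _ hzD).trans ?_, ?_, ?_⟩
    · exact mul_le_mul_of_nonneg_right (by linarith) hd
    · have h := hL _ hzD
      rw [fderivWithin_of_mem_nhds (hint hz)] at h
      exact h.trans (mul_le_mul_of_nonneg_right (by linarith) hd)
    · have h1 := hbq _ hz
      have h2 := mul_le_mul_of_nonneg_left (hS _ hzD) hM0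
      rw [Real.norm_eq_abs] at h2
      linarith
  have hzero : EqOn u u' (interior (Dcone ρ)) := fun p hp =>
    sub_eq_zero.1 (eq_zero_of_kirchhoff hM0 (fun z hz => hS z (interior_subset hz)) hbq hkirch hp)
  exact hzero.of_subset_closure hu.1.continuousOn hu'.1.continuousOn interior_subset
    (closure_interior_Dcone hρ).ge

/-- Existence, uniqueness and smoothness for the Goursat problem on the
double conical region `D_ρ`. -/
theorem stmt0 (ρ : ℝ) (hρ : 0 < ρ) (q : E3 → ℝ)
    (hq : ContDiffOn ℝ 8 q (closedBall (0:E3) ρ)) :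
    ∃ u : E3 × ℝ → ℝ, IsSolOn ρ q u ∧
      (∀ u' : E3 × ℝ → ℝ, IsSolOn ρ q u' → EqOn u u' (Dcone ρ)) ∧
      (ContDiffOn ℝ (⊤ : ℕ∞) q (closedBall (0:E3) ρ) → ContDiffOn ℝ (⊤ : ℕ∞) u (Dcone ρ)) := by
  obtain ⟨u, -, hu⟩ := exists_contDiff_isSolOn hρ 0 hq
  refine ⟨u, hu, fun u' hu' => eqOn_of_isSolOn hρ hq.continuousOn hu hu', fun hq' => ?_⟩
  refine contDiffOn_infty.2 fun j => ?_
  obtain ⟨u', hu's, hu'⟩ := exists_contDiff_isSolOn hρ j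
    (contDiffOn_infty.1 hq' _)
  exact (hu's.contDiffOn.congr (eqOn_of_isSolOn hρ hq.continuousOn hu hu')).of_le
    (by exact_mod_cast Nat.le_add_right j 2)
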